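/- arXiv:2510.06581 — 11 statements merged into one kernel-verified Lean document; each statement's English description precedes it below -/
import Mathlib

section
/- Every chore instance admits a 12-approximate weighted maximin share allocation: there exists an allocation (A_1,…,A_n) such that v_i(A_i) ≤ 12·WMMS_i for every agent i. -/
open Finset

namespace Chores

/-- The cost incurred by agent `j` under the assignment `f` of items to agents
(item `e` is given to agent `f e`); ordered partitions of the item set into `n`
(possibly empty) bundles correspond exactly to such assignments. -/
noncomputable def cost {ι : Type*} [Fintype ι] {n : ℕ} (v : ι → ℝ) (f : ι → Fin n)
    (j : Fin n) : ℝ :=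
  ∑ e ∈ univ.filter (fun e => f e = j), v e

/-- The weighted maximin share of agent `i`, where `w` is the weight vector and
`v` is agent `i`'s own (additive) item cost function:
`WMMS_i = w_i * min over allocations (B_1,…,B_n) of max_j v_i(B_j)/w_j`. -/
noncomputable def WMMS {ι : Type*} [Fintype ι] {n : ℕ} (w : Fin n → ℝ) (v : ι → ℝ)
    (i : Fin n) : ℝ :=
  w i * ⨅ f : ι → Fin n, ⨆ j : Fin n, cost v f j / w j

/-- A chore instance: every agent has a positive weight and nonnegative item costs. -/
def ChoreInstance {ι : Type*} {n : ℕ} (w : Fin n → ℝ) (v : Fin n → ι → ℝ) : Prop :=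
  (∀ i, 0 < w i) ∧ ∀ i e, 0 ≤ v i e

/-- Items whose cost exceeds `T * t` lie in bundles of agents of weight above `t`. -/
lemma sum_heavy_le {n m : ℕ} {w : Fin n → ℝ} {v : Fin m → ℝ} {f : Fin m → Fin n} {T : ℝ}
    (hv : ∀ e, 0 ≤ v e) (hT : 0 ≤ T) (hf : ∀ j, cost v f j ≤ T * w j) (t : ℝ) :
    ∑ e with T * t < v e, v e ≤ T * ∑ j with t < w j, w j := by
  have hle : ∀ e, v e ≤ T * w (f e) := fun e =>
    (single_le_sum (f := v) (fun a _ => hv a) (by simp)).trans (hf (f e))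
  calc ∑ e with T * t < v e, v e
      ≤ ∑ e with t < w (f e), v e := by
        refine sum_le_sum_of_subset_of_nonneg (fun e he => ?_) (fun e _ _ => hv e)
        simp only [mem_filter, mem_univ, true_and] at he ⊢
        exact lt_of_mul_lt_mul_left (he.trans_le (hle e)) hT
    _ = ∑ j with t < w j, cost v f j := by
        rw [← sum_fiberwise_of_maps_to (t := univ.filter fun j => t < w j) (g := f) (by simp)]
        refine sum_congr rfl fun j hj => ?_
        rw [cost, filter_filter]
        refine sum_congr (filter_congr fun e _ => ?_) fun _ _ => rfl
        exact and_iff_right_of_imp fun h => h ▸ (mem_filter.1 hj).2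
    _ ≤ T * ∑ j with t < w j, w j := by
        rw [mul_sum]
        exact sum_le_sum fun j _ => hf j

lemma sum_le_total {n m : ℕ} {w : Fin n → ℝ} {v : Fin m → ℝ} {f : Fin m → Fin n} {T : ℝ}
    (hf : ∀ j, cost v f j ≤ T * w j) : ∑ e, v e ≤ T * ∑ j, w j := by
  rw [mul_sum, ← sum_fiberwise univ f v]
  exact sum_le_sum fun j _ => hf j

/-- If the agents of weight above `t` cannot hold `e + 1` items of size `t`, then the
`e`-th largest item has size at most `t`. -/
lemma apply_le_of_heavy_weight_le {n m : ℕ} {w : Fin n → ℝ} {v : Fin m → ℝ}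
    {f : Fin m → Fin n} {T : ℝ} (hv : ∀ e, 0 ≤ v e) (hT : 0 ≤ T)
    (hf : ∀ j, cost v f j ≤ T * w j) (hanti : Antitone v) {t : ℝ} {e : Fin m}
    (he : ∑ j with t < w j, w j ≤ ((e : ℕ) + 1) * t) : v e ≤ T * t := by
  by_contra! hlt
  have h1 := sum_heavy_le hv hT hf t
  have h2 : ∑ a ∈ Iic e, v a ≤ ∑ a with T * t < v a, v a :=
    sum_le_sum_of_subset_of_nonneg
      (fun a ha => by simpa using hlt.trans_le (hanti (mem_Iic.1 ha))) (fun a _ _ => hv a)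
  have h3 : ∑ a ∈ Iic e, T * t < ∑ a ∈ Iic e, v a :=
    sum_lt_sum_of_nonempty ⟨e, by simp⟩ fun a ha => hlt.trans_le (hanti (mem_Iic.1 ha))
  simp only [sum_const, Fin.card_Iic, nsmul_eq_mul, Nat.cast_add, Nat.cast_one] at h3
  nlinarith [mul_le_mul_of_nonneg_left he hT]

lemma sum_le_two_mul_heavy_weight {n m : ℕ} {w : Fin n → ℝ} {v : Fin m → ℝ}
    {f : Fin m → Fin n} {T : ℝ} (hw : ∀ j, 0 < w j) (hv : ∀ e, 0 ≤ v e) (hT : 0 ≤ T)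
    (hf : ∀ j, cost v f j ≤ T * w j) {t : ℝ} (ht : 0 ≤ t) (E : Finset (Fin m))
    (hE : ∀ e ∈ E, ((e : ℕ) + 1) * t ≤ ∑ j with t < w j, w j) :
    ∑ e ∈ E, v e ≤ 2 * T * ∑ j with t < w j, w j := by
  have hQ : 0 ≤ ∑ j with t < w j, w j := sum_nonneg fun j _ => (hw j).le
  have hcard : (#E : ℝ) * t ≤ ∑ j with t < w j, w j := by
    rcases E.eq_empty_or_nonempty with rfl | hne
    · simpa using hQ
    · refine le_trans ?_ (hE _ (E.max'_mem hne))
      have : #E ≤ (E.max' hne : ℕ) + 1 := by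
        rw [← Fin.card_Iic]
        exact card_le_card fun a ha => mem_Iic.2 (E.le_max' a ha)
      exact mul_le_mul_of_nonneg_right (by exact_mod_cast this) ht
  rw [← sum_filter_add_sum_filter_not E (fun e => T * t < v e)]
  have h1 : ∑ e ∈ E with T * t < v e, v e ≤ T * ∑ j with t < w j, w j :=
    (sum_le_sum_of_subset_of_nonneg (filter_subset_filter _ (subset_univ E))
      (fun a _ _ => hv a)).trans (sum_heavy_le hv hT hf t)
  have h2 : ∑ e ∈ E with ¬ T * t < v e, v e ≤ #E * (T * t) := by
    calc ∑ e ∈ E with ¬ T * t < v e, v e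
        ≤ ∑ e ∈ E with ¬ T * t < v e, T * t :=
          sum_le_sum fun e he => not_lt.1 (mem_filter.1 he).2
      _ ≤ ∑ e ∈ E, T * t :=
          sum_le_sum_of_subset_of_nonneg (filter_subset _ _) (fun _ _ _ => by positivity)
      _ = #E * (T * t) := by simp
  nlinarith [mul_le_mul_of_nonneg_left hcard hT]

/-- Online rounding of a fractional assignment in which every item is covered: every agent
receives at most one item more than her fractional share in each prefix, and receives no
item before her share is positive. -/
lemma exists_rounding {n : ℕ} (x : Fin n → ℕ → ℝ) (hx0 : ∀ i t, 0 ≤ x i t)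
    (hx : ∀ t, 1 ≤ ∑ i, x i t) (m : ℕ) :
    ∃ g : ℕ → Fin n,
      (∀ i, ∀ t ≤ m, ∑ s ∈ range t, (if g s = i then (1 : ℝ) else 0)
        ≤ ∑ s ∈ range t, x i s + 1) ∧
      ∀ t < m, 0 < ∑ s ∈ range (t + 1), x (g t) s := by
  have hn : Nonempty (Fin n) := by
    by_contra h
    rw [not_nonempty_iff] at h
    have := hx 0
    simp at this
    linarith
  induction m with
  | zero => exact ⟨fun _ => hn.some, by simp, by simp⟩
  | succ m ih =>
    obtain ⟨g, hg1, hg2⟩ := ih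
    obtain ⟨i, -, hi⟩ : ∃ i ∈ (univ : Finset (Fin n)),
        ∑ s ∈ range m, (if g s = i then (1 : ℝ) else 0) < ∑ s ∈ range (m + 1), x i s := by
      apply exists_lt_of_sum_lt
      rw [sum_comm, sum_comm (s := univ) (t := range (m + 1))]
      calc ∑ s ∈ range m, ∑ i, (if g s = i then (1 : ℝ) else 0) = m := by simp
        _ < ∑ s ∈ range (m + 1), (1 : ℝ) := by simp
        _ ≤ _ := sum_le_sum fun s _ => hx s
    have hold : ∀ s < m, Function.update g m i s = g s := fun s hs =>
      Function.update_of_ne hs.ne _ _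
    have hcount : ∀ j, ∀ t ≤ m,
        ∑ s ∈ range t, (if Function.update g m i s = j then (1 : ℝ) else 0)
          = ∑ s ∈ range t, (if g s = j then (1 : ℝ) else 0) := fun j t ht =>
      sum_congr rfl fun s hs => by rw [hold s ((mem_range.1 hs).trans_le ht)]
    refine ⟨Function.update g m i, fun j t ht => ?_, fun t ht => ?_⟩
    · rcases Nat.le_succ_iff.1 ht with ht | rfl
      · rw [hcount j t ht]
        exact hg1 j t ht
      · rw [sum_range_succ, hcount j m le_rfl, Function.update_self]
        split_ifs with h
        · subst h
          linarith
        · have := hg1 j m le_rfl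
          rw [sum_range_succ]
          linarith [hx0 j m]
    · rcases Nat.lt_succ_iff_lt_or_eq.1 ht with ht | rfl
      · rw [hold t ht]
        exact hg2 t ht
      · rw [Function.update_self]
        exact (sum_nonneg fun s _ => by split_ifs <;> norm_num).trans_lt hi

/-- Summation by parts against a bounded nonnegative antitone sequence. -/
lemma sum_mul_le_of_prefix_le_one {y v : ℕ → ℝ} {B : ℝ} {m : ℕ} (hanti : Antitone v)
    (hv : ∀ t, 0 ≤ v t) (hB : ∀ t, v t ≤ B) (hy : ∀ t ≤ m, ∑ s ∈ range t, y s ≤ 1) :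
    ∑ s ∈ range m, y s * v s ≤ B := by
  have key : ∀ t ≤ m, ∑ s ∈ range t, y s * v s ≤ B + (∑ s ∈ range t, y s - 1) * v t := by
    intro t
    induction t with
    | zero => intro _; simpa using hB 0
    | succ t ih =>
      intro ht
      have h1 := ih (by omega)
      have h2 := hy (t + 1) ht
      have h3 := hy t (by omega)
      have h4 := hanti (Nat.le_succ t)
      rw [sum_range_succ] at h2 ⊢
      rw [sum_range_succ]
      nlinarith [mul_nonneg (sub_nonneg.2 h2) (sub_nonneg.2 h4)]
  have h1 := key m le_rfl
  nlinarith [mul_nonneg (sub_nonneg.2 (hy m le_rfl)) (hv m)]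

lemma sum_ite_mul_le {a x v : ℕ → ℝ} {B : ℝ} {m : ℕ} (hanti : Antitone v)
    (hv : ∀ t, 0 ≤ v t) (hB0 : 0 ≤ B) (ha : ∀ t, a t = 0 ∨ v t ≤ B) (hx : ∀ t, 0 ≤ x t)
    (hax : ∀ t ≤ m, ∑ s ∈ range t, a s ≤ ∑ s ∈ range t, x s + 1) :
    ∑ s ∈ range m, a s * v s ≤ ∑ s ∈ range m, x s * v s + B := by
  have h := sum_mul_le_of_prefix_le_one (y := fun s => a s - x s) (v := fun s => min (v s) B)
    (B := B) (m := m) (fun s t hst => min_le_min_right B (hanti hst))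
    (fun t => le_min (hv t) hB0) (fun t => min_le_right _ _)
    (fun t ht => by rw [sum_sub_distrib]; linarith [hax t ht])
  simp only [sub_mul, sum_sub_distrib] at h
  have h1 : ∑ s ∈ range m, a s * v s = ∑ s ∈ range m, a s * min (v s) B :=
    sum_congr rfl fun s _ => by
      rcases ha s with h | h
      · simp [h]
      · rw [min_eq_left h]
  have h2 : ∑ s ∈ range m, x s * min (v s) B ≤ ∑ s ∈ range m, x s * v s :=
    sum_le_sum fun s _ => mul_le_mul_of_nonneg_left (min_le_left _ _) (hx s)
  linarith

/-- Total weight of the agents at least as heavy as `i`. -/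
noncomputable def weightAbove {n : ℕ} (w : Fin n → ℝ) (i : Fin n) : ℝ :=
  ∑ j with w i ≤ w j, w j

lemma weightAbove_pos {n : ℕ} {w : Fin n → ℝ} (hw : ∀ j, 0 < w j) (i : Fin n) :
    0 < weightAbove w i :=
  sum_pos (fun j _ => hw j) ⟨i, by simp⟩

/-- A set of agents, each with `weightAbove` at most `y`,
has total weight at most `y`. -/
lemma sum_le_of_weightAbove_le {n : ℕ} {w : Fin n → ℝ} (hw : ∀ j, 0 < w j) {y : ℝ}
    (hy : 0 ≤ y) (S : Finset (Fin n)) (hS : ∀ j ∈ S, weightAbove w j ≤ y) :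
    ∑ j ∈ S, w j ≤ y := by
  rcases S.eq_empty_or_nonempty with rfl | hne
  · simpa using hy
  · obtain ⟨k, hk, hmin⟩ := exists_min_image S w hne
    exact (sum_le_sum_of_subset_of_nonneg (fun j hj => by simpa using hmin j hj)
      (fun j _ _ => (hw j).le)).trans (hS k hk)

/-- The lightest agent to whom the `e`-th largest item is guaranteed to be acceptable. -/
lemma exists_lightest {n : ℕ} [NeZero n] {w : Fin n → ℝ} (hw : ∀ j, 0 < w j) (e : ℕ) :
    ∃ r, ∑ j with w r < w j, w j ≤ ((e : ℝ) + 1) * w r ∧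
      ∀ d, w d < w r → ((e : ℝ) + 1) * w d < ∑ j with w d < w j, w j := by
  obtain ⟨k, -, hk⟩ := exists_max_image (univ : Finset (Fin n)) w ⟨0, mem_univ _⟩
  obtain ⟨r, hr, hmin⟩ := exists_min_image
    (univ.filter fun r => ∑ j with w r < w j, w j ≤ ((e : ℝ) + 1) * w r) w
    ⟨k, by
      have : (univ.filter fun j => w k < w j) = ∅ := by
        ext j; simpa using hk j (mem_univ _)
      simp only [mem_filter, mem_univ, true_and, this, sum_empty]
      have := hw k
      positivity⟩
  refine ⟨r, (mem_filter.1 hr).2, fun d hd => ?_⟩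
  by_contra! hle
  exact absurd (hmin d (by simpa using hle)) (not_le.2 hd)

/-- Items that are only guaranteed acceptable to a group of heavy agents of total weight at
most `y` have total cost at most `2 * T * y`. -/
lemma sum_le_two_mul_of_weightAbove_le {n m : ℕ} {w : Fin n → ℝ} {v : Fin m → ℝ}
    {f : Fin m → Fin n} {T : ℝ} (hw : ∀ j, 0 < w j) (hv : ∀ e, 0 ≤ v e) (hT : 0 ≤ T)
    (hf : ∀ j, cost v f j ≤ T * w j) {r : ℕ → Fin n}
    (hr : ∀ e d, w d < w (r e) → ((e : ℝ) + 1) * w d < ∑ j with w d < w j, w j)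
    {y : ℝ} (hy : 0 ≤ y) :
    ∑ e ∈ univ.filter (fun e : Fin m => weightAbove w (r e) ≤ y), v e ≤ 2 * T * y := by
  by_cases hex : (univ.filter fun d => y < weightAbove w d).Nonempty
  · obtain ⟨d, hd, hmax⟩ := exists_max_image _ w hex
    simp only [mem_filter, mem_univ, true_and] at hd hmax
    refine (sum_le_two_mul_heavy_weight hw hv hT hf (hw d).le _ fun e he => ?_).trans ?_
    · simp only [mem_filter, mem_univ, true_and] at he
      refine (hr e d ?_).le
      by_contra! hle
      refine absurd (hd.trans_le ?_) (not_lt.2 he)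
      exact sum_le_sum_of_subset_of_nonneg
        (fun j hj => by simp at hj ⊢; exact hle.trans hj) (fun j _ _ => (hw j).le)
    · refine mul_le_mul_of_nonneg_left (sum_le_of_weightAbove_le hw hy _ fun j hj => ?_)
        (by positivity)
      by_contra! hlt
      exact absurd (hmax j hlt) (by simpa using hj)
  · rw [not_nonempty_iff_eq_empty, filter_eq_empty_iff] at hex
    have h1 := sum_le_of_weightAbove_le hw hy univ fun j hj => not_lt.1 (hex hj)
    have h2 := sum_le_total hf
    have h3 : ∑ e ∈ univ.filter (fun e : Fin m => weightAbove w (r e) ≤ y), v e ≤ ∑ e, v e :=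
      sum_le_sum_of_subset_of_nonneg (filter_subset _ _) (fun e _ _ => hv e)
    nlinarith [mul_le_mul_of_nonneg_left h1 hT, mul_nonneg hT hy]

/-- Instances in which all agents rank the items in the same order. -/
lemma exists_allocation_of_antitone {n m : ℕ} [NeZero n] {w : Fin n → ℝ} {v : Fin n → Fin m → ℝ}
    {T : Fin n → ℝ} {F : Fin n → Fin m → Fin n} (hw : ∀ j, 0 < w j)
    (hv : ∀ i e, 0 ≤ v i e) (hT : ∀ i, 0 ≤ T i) (hF : ∀ i j, cost (v i) (F i) j ≤ T i * w j)
    (hanti : ∀ i, Antitone (v i)) :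
    ∃ g : Fin m → Fin n, ∀ i, cost (v i) g i ≤ 9 * (T i * w i) := by
  choose r hr1 hr2 using exists_lightest hw
  let x : Fin n → ℕ → ℝ := fun i e =>
    if w (r e) ≤ w i ∧ weightAbove w (r e) ≤ 2 * weightAbove w i then
      2 * w i / weightAbove w (r e) else 0
  have hP := weightAbove_pos hw
  have hx0 : ∀ i e, 0 ≤ x i e := fun i e => by
    have := hw i
    have := hP (r e)
    simp only [x]
    split_ifs <;> positivity
  have hx1 : ∀ e, 1 ≤ ∑ i, x i e := fun e => by
    simp only [x]
    rw [← sum_filter, ← sum_div, ← mul_sum, one_le_div (hP _)]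
    have h1 : ∑ i with w (r e) ≤ w i ∧ ¬ weightAbove w (r e) ≤ 2 * weightAbove w i, w i
        ≤ weightAbove w (r e) / 2 :=
      sum_le_of_weightAbove_le hw (half_pos (hP _)).le _ fun j hj => by
        have := (mem_filter.1 hj).2.2
        linarith
    have h2 : weightAbove w (r e)
        = ∑ i with w (r e) ≤ w i ∧ weightAbove w (r e) ≤ 2 * weightAbove w i, w i
          + ∑ i with w (r e) ≤ w i ∧ ¬ weightAbove w (r e) ≤ 2 * weightAbove w i, w i := by
      rw [← filter_filter, ← filter_filter, sum_filter_add_sum_filter_not]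
      rfl
    linarith
  obtain ⟨g, hg1, hg2⟩ := exists_rounding x hx0 hx1 m
  refine ⟨fun e => g e, fun i => ?_⟩
  let V : ℕ → ℝ := fun t => if h : t < m then v i ⟨t, h⟩ else 0
  have hV0 : ∀ t, 0 ≤ V t := fun t => by
    simp only [V]
    split_ifs
    exacts [hv _ _, le_rfl]
  have hVanti : Antitone V := fun s t hst => by
    by_cases ht : t < m
    · simpa [V, ht, hst.trans_lt ht] using hanti i (show (⟨s, _⟩ : Fin m) ≤ ⟨t, ht⟩ from hst)
    · simpa [V, ht] using hV0 s
  have hVe : ∀ e : Fin m, V e = v i e := fun e => by simp [V]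
  have hround := sum_ite_mul_le (a := fun s => if g s = i then 1 else 0) (x := x i) (v := V)
    (B := T i * w i) (m := m) hVanti hV0 (mul_nonneg (hT i) (hw i).le)
    (fun t => by
      by_cases hgt : g t = i
      swap
      · simp [hgt]
      right
      by_cases ht : t < m
      swap
      · simpa [V, ht] using mul_nonneg (hT i) (hw i).le
      have hpos := hg2 t ht
      rw [hgt] at hpos
      obtain ⟨s, hs, hxs⟩ : ∃ s ∈ range (t + 1), 0 < x i s := by
        by_contra! hcon
        exact absurd (sum_nonpos hcon) (not_le.2 hpos)
      have hst : s ≤ t := Nat.lt_succ_iff.1 (mem_range.1 hs)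
      have hsr : w (r s) ≤ w i := by
        by_contra hcon
        simp [x, hcon] at hxs
      have hvs := apply_le_of_heavy_weight_le (hv i) (hT i) (hF i) (hanti i)
        (e := ⟨s, hst.trans_lt ht⟩) (hr1 s)
      calc V t ≤ V s := hVanti hst
        _ = v i ⟨s, hst.trans_lt ht⟩ := by simp [V, hst.trans_lt ht]
        _ ≤ T i * w (r s) := hvs
        _ ≤ T i * w i := mul_le_mul_of_nonneg_left hsr (hT i))
    (hx0 i) (hg1 i)
  have hfrac : ∑ s ∈ range m, x i s * V s ≤ 8 * (T i * w i) := by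
    rw [← Fin.sum_univ_eq_sum_range (fun s => x i s * V s)]
    have hbound : ∀ e : Fin m, x i e * V e
        ≤ if weightAbove w (r e) ≤ 2 * weightAbove w i then
            2 * w i / weightAbove w i * v i e else 0 := fun e => by
      rw [hVe]
      simp only [x]
      by_cases h2 : weightAbove w (r e) ≤ 2 * weightAbove w i
      swap
      · simp [h2]
      have hq : 0 ≤ 2 * w i / weightAbove w i := by
        have := hw i
        have := hP i
        positivity
      by_cases h1 : w (r e) ≤ w i
      swap
      · simpa [h1, h2] using mul_nonneg hq (hv i e)
      simp only [h1, h2, and_self, if_true]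
      refine mul_le_mul_of_nonneg_right ?_ (hv i e)
      refine div_le_div_of_nonneg_left (by linarith [hw i]) (hP i) ?_
      exact sum_le_sum_of_subset_of_nonneg
        (fun j hj => by simp at hj ⊢; exact h1.trans hj) (fun j _ _ => (hw j).le)
    refine (sum_le_sum fun e _ => hbound e).trans ?_
    rw [← sum_filter, ← mul_sum]
    have hsum := sum_le_two_mul_of_weightAbove_le hw (hv i) (hT i) (hF i) hr2
      (y := 2 * weightAbove w i) (by linarith [hP i])
    have hPi := hP i
    calc _ ≤ 2 * w i / weightAbove w i * (2 * T i * (2 * weightAbove w i)) :=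
          mul_le_mul_of_nonneg_left hsum (by have := hw i; positivity)
      _ = 8 * (T i * w i) := by field_simp; ring
  have hcost : cost (v i) (fun e : Fin m => g e) i
      = ∑ s ∈ range m, (if g s = i then (1 : ℝ) else 0) * V s := by
    rw [← Fin.sum_univ_eq_sum_range (fun s => (if g s = i then (1 : ℝ) else 0) * V s)]
    simp [cost, sum_filter, hVe]
  rw [hcost]
  linarith

/-- Reordering the items does not change bundle costs. -/
lemma cost_comp_perm {n m : ℕ} (v : Fin m → ℝ) (f : Fin m → Fin n) (σ : Equiv.Perm (Fin m))
    (j : Fin n) : cost (v ∘ σ) (f ∘ σ) j = cost v f j := by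
  simp only [cost, sum_filter, Function.comp_apply]
  exact Equiv.sum_comp σ fun e => if f e = j then v e else 0

lemma exists_antitone_comp_perm {m : ℕ} (v : Fin m → ℝ) :
    ∃ σ : Equiv.Perm (Fin m), Antitone (v ∘ σ) :=
  ⟨Tuple.sort (fun e => -v e), fun a b hab => by
    simpa using Tuple.monotone_sort (fun e => -v e) hab⟩

/-- Each slot of an assignment of ranks can be filled with an item that its owner finds at
most as costly as the item of that rank. -/
lemma exists_perm_le {n m : ℕ} (v : Fin n → Fin m → ℝ) (σ : Fin n → Equiv.Perm (Fin m))
    (hσ : ∀ i, Antitone (v i ∘ σ i)) (g : Fin m → Fin n) :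
    ∃ π : Equiv.Perm (Fin m), ∀ k, v (g k) (π k) ≤ v (g k) (σ (g k) k) := by
  obtain ⟨π, hinj, hπ⟩ := (all_card_le_biUnion_card_iff_exists_injective
    (fun k => univ.filter fun e => v (g k) e ≤ v (g k) (σ (g k) k))).1 fun K => by
      rcases K.eq_empty_or_nonempty with rfl | hne
      · simp
      · calc #K ≤ #(Ici (K.min' hne)) :=
              card_le_card fun a ha => mem_Ici.2 (K.min'_le a ha)
          _ = #((Ici (K.min' hne)).map (σ (g (K.min' hne))).toEmbedding) := (card_map _).symm
          _ ≤ _ := card_le_card fun e he => by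
              obtain ⟨a, ha, rfl⟩ := mem_map.1 he
              exact mem_biUnion.2 ⟨_, K.min'_mem hne,
                mem_filter.2 ⟨mem_univ _, hσ _ (mem_Ici.1 ha)⟩⟩
  exact ⟨Equiv.ofBijective π (Finite.injective_iff_bijective.1 hinj),
    fun k => (mem_filter.1 (hπ k)).2⟩

lemma exists_optimal_partition {n m : ℕ} [NeZero n] {w : Fin n → ℝ} (hw : ∀ j, 0 < w j)
    {v : Fin m → ℝ} (hv : ∀ e, 0 ≤ v e) :
    ∃ (T : ℝ) (f : Fin m → Fin n), 0 ≤ T ∧ (∀ j, cost v f j ≤ T * w j) ∧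
      ∀ i, WMMS w v i = T * w i := by
  obtain ⟨f, hf⟩ := exists_eq_ciInf_of_finite
    (f := fun f : Fin m → Fin n => ⨆ j : Fin n, cost v f j / w j)
  have hle : ∀ j, cost v f j / w j ≤ ⨆ j : Fin n, cost v f j / w j :=
    le_ciSup (Set.finite_range fun j => cost v f j / w j).bddAbove
  refine ⟨⨆ j : Fin n, cost v f j / w j, f, ?_, fun j => ?_, fun i => ?_⟩
  · exact (div_nonneg (sum_nonneg fun e _ => hv e) (hw 0).le).trans (hle 0)
  · exact (div_le_iff₀ (hw j)).1 (hle j)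
  · rw [WMMS, ← hf, mul_comm]

/-- Every chore instance admits a 12-approximate weighted maximin
share allocation: there is an allocation `(A_1,…,A_n)` (given by an assignment `f`,
with `A_i = f⁻¹(i)`) such that `v_i(A_i) ≤ 12 · WMMS_i` for every agent `i`. -/
theorem exists_twelve_WMMS_allocation {n m : ℕ} [NeZero n]
    (w : Fin n → ℝ) (v : Fin n → Fin m → ℝ) (hI : ChoreInstance w v) :
    ∃ f : Fin m → Fin n, ∀ i : Fin n, cost (v i) f i ≤ 12 * WMMS w (v i) i := by
  obtain ⟨hw, hv⟩ := hI
  choose T F hT hF hWMMS using fun i => exists_optimal_partition hw (hv i)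
  choose σ hσ using fun i => exists_antitone_comp_perm (v i)
  obtain ⟨g, hg⟩ := exists_allocation_of_antitone (v := fun i => v i ∘ σ i)
    (F := fun i => F i ∘ σ i) hw (fun i e => hv i _) hT
    (fun i j => (cost_comp_perm _ _ _ _).trans_le (hF i j)) hσ
  obtain ⟨π, hπ⟩ := exists_perm_le v σ hσ g
  refine ⟨g ∘ π.symm, fun i => ?_⟩
  have hle : cost (v i) (g ∘ π.symm) i ≤ cost (v i ∘ σ i) g i := by
    rw [← cost_comp_perm (v i) (g ∘ π.symm) π]
    simp only [cost, Function.comp_apply, Equiv.symm_apply_apply]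
    refine sum_le_sum fun k hk => ?_
    obtain rfl := (mem_filter.1 hk).2
    exact hπ k
  rw [hWMMS]
  linarith [hg i, mul_nonneg (hT i) (hw i).le]

end Chores
end

section
/- Let α ≥ 1. If every canonical chore instance admits an α-WMMS allocation, then every chore instance admits a 4α-WMMS allocation. -/
open Finset

namespace Chores

/-- A canonical chore instance: weights are nonincreasing, sum to `1`, and each is
`w_1/2^p`; each agent's total cost is `1` and every item cost is `w_1/2^q`;
the instance is identically ordered (IDO), i.e. all agents' costs are nonincreasing
along the item order; and every agent's WMMS equals her weight. -/
def Canonical {n m : ℕ} [NeZero n] (w : Fin n → ℝ) (v : Fin n → Fin m → ℝ) : Prop :=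
  ChoreInstance w v ∧
  (∀ i j : Fin n, i ≤ j → w j ≤ w i) ∧
  (∑ i, w i = 1) ∧
  (∀ i, ∃ p : ℕ, w i = w 0 / 2 ^ p) ∧
  (∀ i, ∑ e, v i e = 1) ∧
  (∀ i e, ∃ q : ℕ, v i e = w 0 / 2 ^ q) ∧
  (∀ i : Fin n, ∀ e e' : Fin m, e ≤ e' → v i e' ≤ v i e) ∧
  (∀ i, WMMS w (v i) i = w i)

theorem cost_eq_sum_ite {ι : Type*} [Fintype ι] {n : ℕ} (v : ι → ℝ) (f : ι → Fin n)
    (j : Fin n) : cost v f j = ∑ e, if f e = j then v e else 0 := by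
  rw [cost, sum_filter]

theorem sum_cost {ι : Type*} [Fintype ι] {n : ℕ} (v : ι → ℝ) (f : ι → Fin n) :
    ∑ j, cost v f j = ∑ e, v e := by
  simp only [cost_eq_sum_ite]
  rw [sum_comm]
  simp

theorem exists_cost_le_mul {ι : Type*} [Fintype ι] {n : ℕ} [NeZero n] (w : Fin n → ℝ)
    (hw : ∀ i, 0 < w i) (v : ι → ℝ) :
    ∃ f : ι → Fin n, ∀ j, cost v f j ≤
      (⨅ f : ι → Fin n, ⨆ j : Fin n, cost v f j / w j) * w j := by
  obtain ⟨f, hf⟩ := exists_eq_ciInf_of_finite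
    (f := fun f : ι → Fin n => ⨆ j : Fin n, cost v f j / w j)
  refine ⟨f, fun j => ?_⟩
  rw [← hf, ← div_le_iff₀ (hw j)]
  exact le_ciSup (f := fun j => cost v f j / w j) (Set.finite_range _).bddAbove j

/-- If the items can be split so that every bundle costs exactly its weight, then the
weighted maximin share is the weight. -/
theorem WMMS_eq_of_cost_eq {ι : Type*} [Fintype ι] {n : ℕ} [NeZero n] (w : Fin n → ℝ)
    (hw : ∀ i, 0 < w i) (v : ι → ℝ) (g : ι → Fin n) (hg : ∀ j, cost v g j = w j)
    (i : Fin n) : WMMS w v i = w i := by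
  suffices h : (⨅ f : ι → Fin n, ⨆ j : Fin n, cost v f j / w j) = 1 by
    rw [WMMS, h, mul_one]
  apply le_antisymm
  · refine (ciInf_le (Set.finite_range _).bddBelow g).trans ?_
    exact ciSup_le fun j => by rw [hg, div_self (hw j).ne']
  · refine le_ciInf fun f => ?_
    have hsum : ∑ j, w j ≤ ∑ j, cost v f j := by
      rw [sum_cost, ← sum_cost v g]
      exact (sum_congr rfl fun j _ => (hg j).symm).le
    obtain ⟨j, -, hj⟩ := exists_le_of_sum_le univ_nonempty hsum
    exact ((one_le_div (hw j)).2 hj).trans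
      (le_ciSup (f := fun j => cost v f j / w j) (Set.finite_range _).bddAbove j)

theorem exists_equiv_antitone {ι : Type*} [Fintype ι] (v : ι → ℝ) :
    ∃ σ : Fin (Fintype.card ι) ≃ ι, Antitone (v ∘ σ) := by
  let e := (Fintype.equivFin ι).symm
  refine ⟨(Tuple.sort fun k => -v (e k)).trans e, fun a b hab => ?_⟩
  have := Tuple.monotone_sort (fun k => -v (e k)) hab
  simpa using this

/-- An assignment for the identically ordered instance transfers to the original one
without increasing anybody's cost. -/
theorem exists_cost_le_of_ordered {ι : Type*} [Fintype ι] {n M : ℕ} [NeZero n] (v : Fin n → ι → ℝ)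
    (σ : Fin n → Fin M ≃ ι) (hσ : ∀ i, Antitone (v i ∘ σ i)) (f : Fin M → Fin n) :
    ∃ g : ι → Fin n, ∀ i, cost (v i) g i ≤ cost (v i ∘ σ i) f i := by
  classical
  obtain ⟨π, hinj, hπ⟩ := (all_card_le_biUnion_card_iff_exists_injective
    (fun k : Fin M => univ.filter fun e => v (f k) e ≤ v (f k) (σ (f k) k))).1 (by
      intro s
      rcases s.eq_empty_or_nonempty with rfl | hs
      · simp
      set k := s.min' hs
      calc s.card ≤ (Ici k).card := card_le_card fun x hx => mem_Ici.2 (s.min'_le x hx)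
        _ = ((Ici k).map (σ (f k)).toEmbedding).card := (card_map _).symm
        _ ≤ _ := by
          refine card_le_card fun e he => ?_
          obtain ⟨x, hx, rfl⟩ := mem_map.1 he
          exact mem_biUnion.2 ⟨k, s.min'_mem hs, by
            simpa using hσ (f k) (mem_Ici.1 hx)⟩)
  have hcard : Fintype.card ι = M := by
    simpa using (Fintype.card_congr (σ 0)).symm
  have hbij : Function.Bijective π :=
    (Fintype.bijective_iff_injective_and_card π).2 ⟨hinj, by simp [hcard]⟩
  let E := Equiv.ofBijective π hbij
  refine ⟨f ∘ E.symm, fun i => ?_⟩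
  rw [cost_eq_sum_ite, cost_eq_sum_ite, ← E.sum_comp]
  refine sum_le_sum fun k _ => ?_
  by_cases h : f k = i
  · subst h
    simpa [E] using hπ k
  · simp [h]

/-- An assignment with `α`-bounded cost exists for instances that are canonical up to
reordering agents and items and up to scaling. -/
theorem exists_cost_le_of_perfect (α : ℝ)
    (hcanonical : ∀ (n' m' : ℕ) [NeZero n'] (w' : Fin n' → ℝ) (v' : Fin n' → Fin m' → ℝ),
      Canonical w' v' →
        ∃ f : Fin m' → Fin n', ∀ i : Fin n', cost (v' i) f i ≤ α * WMMS w' (v' i) i)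
    {ι : Type*} [Fintype ι] {n : ℕ} [NeZero n] {W : ℝ} (hW : 0 < W) (p : Fin n → ℕ)
    (hp : ∃ i, p i = 0) (q : Fin n → ι → ℕ) (g : Fin n → ι → Fin n)
    (hg : ∀ i j, cost (fun e => W / 2 ^ q i e) (g i) j = W / 2 ^ p j) :
    ∃ f : ι → Fin n, ∀ i, cost (fun e => W / 2 ^ q i e) f i ≤ α * (W / 2 ^ p i) := by
  set S : ℝ := ∑ i, W / 2 ^ p i
  have hS : 0 < S := sum_pos (fun i _ => by positivity) univ_nonempty
  have hS' : S ≠ 0 := hS.ne'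
  choose σ hσ using fun i => exists_equiv_antitone fun e => W / 2 ^ q i e
  let τ := Tuple.sort p
  have hτ : Monotone (p ∘ τ) := Tuple.monotone_sort p
  have hτ0 : p (τ 0) = 0 := by
    obtain ⟨i, hi⟩ := hp
    have : p (τ 0) ≤ p (τ (τ.symm i)) := hτ (Fin.zero_le _)
    simpa [hi] using this
  let w' : Fin n → ℝ := fun a => W / 2 ^ p (τ a) / S
  let v' : Fin n → Fin (Fintype.card ι) → ℝ := fun a k => W / 2 ^ q (τ a) (σ (τ a) k) / S
  have hw' : ∀ a, 0 < w' a := fun a => by positivity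
  have hw0 : w' 0 = W / S := by simp [w', hτ0]
  have hperfect : ∀ a b, cost (v' a) (fun k => τ.symm (g (τ a) (σ (τ a) k))) b = w' b := by
    intro a b
    simp only [w', ← hg (τ a) (τ b)]
    rw [cost_eq_sum_ite, cost_eq_sum_ite, ← (σ (τ a)).sum_comp, sum_div]
    refine sum_congr rfl fun k _ => ?_
    simp only [Equiv.symm_apply_eq, v']
    split_ifs <;> simp
  have hsum : ∑ a, w' a = 1 := by
    simp only [w', ← sum_div]
    rw [Equiv.sum_comp τ (fun i => W / 2 ^ p i)]
    exact div_self hS'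
  have hWMMS : ∀ a, WMMS w' (v' a) a = w' a := fun a =>
    WMMS_eq_of_cost_eq w' hw' _ _ (hperfect a) a
  obtain ⟨f, hf⟩ := hcanonical n _ w' v' (by
    refine ⟨⟨hw', fun a k => by positivity⟩, fun a b hab => ?_, hsum, fun a => ⟨p (τ a), ?_⟩,
      fun a => ?_, fun a k => ⟨q (τ a) (σ (τ a) k), ?_⟩, fun a k l hkl => ?_, hWMMS⟩
    · have : p (τ a) ≤ p (τ b) := hτ hab
      simp only [w']
      gcongr
      norm_num
    · rw [hw0]; exact div_right_comm _ _ _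
    · rw [← sum_cost _ fun k => τ.symm (g (τ a) (σ (τ a) k)), ← hsum]
      exact sum_congr rfl fun b _ => hperfect a b
    · rw [hw0]; exact div_right_comm _ _ _
    · exact div_le_div_of_nonneg_right (hσ (τ a) hkl) hS.le)
  obtain ⟨h, hh⟩ := exists_cost_le_of_ordered _ σ hσ (τ ∘ f)
  refine ⟨h, fun i => (hh i).trans ?_⟩
  have := hf (τ.symm i)
  rw [hWMMS] at this
  simp only [w', Equiv.apply_symm_apply, ← mul_div_assoc, le_div_iff₀ hS] at this
  refine le_trans (le_of_eq ?_) (this.trans_eq (by ring))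
  rw [cost_eq_sum_ite, cost_eq_sum_ite, sum_mul]
  refine sum_congr rfl fun k _ => ?_
  simp only [Function.comp, Equiv.eq_symm_apply, v', Equiv.apply_symm_apply, ite_mul, zero_mul,
    div_mul_cancel₀ _ hS']

theorem exists_pow_round {W x : ℝ} (hx : 0 < x) (hxW : x ≤ W) :
    ∃ p : ℕ, W / 2 ^ (p + 1) < x ∧ x ≤ W / 2 ^ p := by
  have hW := hx.trans_le hxW
  obtain ⟨p, h1, h2⟩ := exists_nat_pow_near_of_lt_one (div_pos hx hW) ((div_le_one hW).2 hxW)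
    (y := (1 / 2 : ℝ)) (by norm_num) (by norm_num)
  refine ⟨p, ?_, ?_⟩
  · rw [lt_div_iff₀ hW] at h1
    simpa [div_eq_mul_inv, mul_comm] using h1
  · rw [div_le_iff₀ hW] at h2
    simpa [div_eq_mul_inv, mul_comm] using h2

theorem exists_round_items {ι : Type*} [Fintype ι] {n : ℕ} {W : ℝ} (u : ι → ℝ)
    (hu : ∀ e, 0 ≤ u e) (huW : ∀ e, u e ≤ W) (f : ι → Fin n) (b : Fin n → ℝ)
    (hb : ∀ j, 0 < b j) (hf : ∀ j, cost u f j ≤ b j) :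
    ∃ q : ι → ℕ, (∀ e, u e ≤ 2 * (W / 2 ^ q e)) ∧
      ∀ j, cost (fun e => W / 2 ^ q e) f j < b j := by
  classical
  have hround : ∀ e, ∃ r : ℕ, 0 < u e → W / 2 ^ r < u e ∧ u e ≤ 2 * (W / 2 ^ r) := by
    intro e
    by_cases he : 0 < u e
    · obtain ⟨p, h1, h2⟩ := exists_pow_round he (huW e)
      refine ⟨p + 1, fun _ => ⟨h1, h2.trans_eq ?_⟩⟩
      rw [pow_succ]; field_simp
    · exact ⟨0, fun h => absurd h he⟩
  choose r hr using hround
  have hlim : ∀ j, Filter.Tendsto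
      (fun N : ℕ => cost (fun e => if 0 < u e then W / 2 ^ r e else W / 2 ^ N) f j)
      Filter.atTop (nhds (cost (fun e => if 0 < u e then W / 2 ^ r e else 0) f j)) := by
    intro j
    refine tendsto_finsetSum _ fun e _ => ?_
    dsimp only
    split_ifs
    · exact tendsto_const_nhds
    · exact tendsto_const_nhds.div_atTop (tendsto_pow_atTop_atTop_of_one_lt one_lt_two)
  have hlt : ∀ j, cost (fun e => if 0 < u e then W / 2 ^ r e else 0) f j < b j := by
    intro j
    by_cases h : ∃ e, f e = j ∧ 0 < u e
    · obtain ⟨e, he, hpos⟩ := h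
      refine lt_of_lt_of_le (sum_lt_sum (fun x _ => ?_) ⟨e, by simpa using he, ?_⟩) (hf j)
      · split_ifs with hx
        · exact (hr x hx).1.le
        · exact hu x
      · simpa [hpos] using (hr e hpos).1
    · push Not at h
      refine lt_of_eq_of_lt (sum_eq_zero fun e he => ?_) (hb j)
      exact if_neg (h e (by simpa using he)).not_gt
  obtain ⟨N, hN⟩ := (Filter.eventually_all.2 fun j => (hlim j).eventually_lt_const (hlt j)).exists
  refine ⟨fun e => if 0 < u e then r e else N, fun e => ?_, fun j => ?_⟩
  · by_cases he : 0 < u e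
    · simpa [he] using (hr e he).2
    · have : 0 ≤ W := (hu e).trans (huW e)
      exact (not_lt.1 he).trans (by positivity)
  · refine lt_of_eq_of_lt (sum_congr rfl fun e _ => ?_) (hN j)
    dsimp only
    split_ifs <;> rfl

theorem exists_dyadic_gap {ι : Type*} {W : ℝ} (hW : 0 < W) (s : Finset ι) (q : ι → ℕ) (p : ℕ)
    (h : ∑ e ∈ s, W / 2 ^ q e < W / 2 ^ p) :
    ∃ k Q : ℕ, 0 < k ∧ W / 2 ^ p - ∑ e ∈ s, W / 2 ^ q e = k * (W / 2 ^ Q) := by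
  set Q := p + ∑ e ∈ s, q e
  have key : ∀ r ≤ Q, W / 2 ^ r = ((2 ^ (Q - r) : ℕ) : ℝ) * (W / 2 ^ Q) := by
    intro r hr
    obtain ⟨t, ht⟩ := Nat.exists_eq_add_of_le hr
    rw [ht]
    simp only [add_tsub_cancel_left, pow_add, Nat.cast_pow, Nat.cast_ofNat]
    field_simp
  have hq : ∑ e ∈ s, W / 2 ^ q e = ((∑ e ∈ s, 2 ^ (Q - q e) : ℕ) : ℝ) * (W / 2 ^ Q) := by
    rw [Nat.cast_sum, sum_mul]
    refine sum_congr rfl fun e he => key _ ?_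
    exact (single_le_sum (fun _ _ => Nat.zero_le _) he).trans (Nat.le_add_left _ _)
  have hp := key p (Nat.le_add_right _ _)
  rw [hq, hp] at h ⊢
  have hlt : ∑ e ∈ s, 2 ^ (Q - q e) < 2 ^ (Q - p) := by
    exact_mod_cast lt_of_mul_lt_mul_right h (by positivity)
  refine ⟨2 ^ (Q - p) - ∑ e ∈ s, 2 ^ (Q - q e), Q, Nat.sub_pos_of_lt hlt, ?_⟩
  rw [Nat.cast_sub hlt.le, sub_mul]

/-- Prescribed positive dyadic amounts can be filled by any sufficiently large number of items
whose costs are powers of two times `W`. -/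
theorem exists_filling {n : ℕ} [NeZero n] (W : ℝ) (k Q : Fin n → ℕ) (hk : ∀ j, 0 < k j)
    {K : ℕ} (hK : ∑ j, k j ≤ K) :
    ∃ (q : Fin K → ℕ) (g : Fin K → Fin n),
      ∀ j, cost (fun e => W / 2 ^ q e) g j = k j * (W / 2 ^ Q j) := by
  induction K, hK using Nat.le_induction with
  | base =>
    let E : Fin (∑ j, k j) ≃ Σ j, Fin (k j) := finSigmaFinEquiv.symm
    refine ⟨fun e => Q (E e).1, fun e => (E e).1, fun j => ?_⟩
    rw [cost_eq_sum_ite, E.sum_comp (fun x => if x.1 = j then W / 2 ^ Q x.1 else 0),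
      Fintype.sum_sigma]
    simp
  | succ K hK ih =>
    obtain ⟨q, g, h⟩ := ih
    obtain ⟨K, rfl⟩ : ∃ L, K = L + 1 := by
      refine Nat.exists_eq_succ_of_ne_zero (Nat.pos_iff_ne_zero.1 (lt_of_lt_of_le ?_ hK))
      exact sum_pos (fun j _ => hk j) univ_nonempty
    refine ⟨Fin.cons (q 0 + 1) (Fin.cons (q 0 + 1) (Fin.tail q)), Fin.cons (g 0) g, fun j => ?_⟩
    rw [← h j]
    simp only [cost_eq_sum_ite, Fin.sum_univ_succ, Fin.cons_zero, Fin.cons_succ, Fin.tail,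
      ← add_assoc]
    congr 1
    split_ifs
    · rw [pow_succ]; field_simp; norm_num
    · simp

theorem cost_sumType {ι κ : Type*} [Fintype ι] [Fintype κ] {n : ℕ} (v : ι ⊕ κ → ℝ)
    (f : ι ⊕ κ → Fin n) (j : Fin n) :
    cost v f j = cost (v ∘ Sum.inl) (f ∘ Sum.inl) j + cost (v ∘ Sum.inr) (f ∘ Sum.inr) j := by
  simp only [cost_eq_sum_ite, Fintype.sum_sum_type, Function.comp]

/-- Let `α ≥ 1`. If every canonical chore instance admits an
`α`-WMMS allocation, then every chore instance admits a `4α`-WMMS allocation. -/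
theorem canonical_reduction (α : ℝ) (hα : 1 ≤ α)
    (hcanonical : ∀ (n' m' : ℕ) [NeZero n'] (w' : Fin n' → ℝ) (v' : Fin n' → Fin m' → ℝ),
      Canonical w' v' →
        ∃ f : Fin m' → Fin n', ∀ i : Fin n', cost (v' i) f i ≤ α * WMMS w' (v' i) i)
    {n m : ℕ} [NeZero n] (w : Fin n → ℝ) (v : Fin n → Fin m → ℝ)
    (hI : ChoreInstance w v) :
    ∃ f : Fin m → Fin n, ∀ i : Fin n, cost (v i) f i ≤ 4 * α * WMMS w (v i) i := by
  have hw := hI.1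
  have hv := hI.2
  choose f hf using fun i => exists_cost_le_mul w hw (v i)
  set c : Fin n → ℝ := fun i => ⨅ f : Fin m → Fin n, ⨆ j : Fin n, cost (v i) f j / w j
  have hWMMS : ∀ i, WMMS w (v i) i = w i * c i := fun i => rfl
  have hcost : ∀ i e, v i e ≤ c i * w (f i e) := fun i e =>
    (single_le_sum (fun x _ => hv i x) (by simp)).trans (hf i (f i e))
  have hc0 : ∀ i, 0 ≤ c i := fun i => nonneg_of_mul_nonneg_left
    ((sum_nonneg fun e _ => hv i e).trans (hf i i)) (hw i)
  by_cases hzero : ∃ i, c i = 0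
  · obtain ⟨i, hi⟩ := hzero
    have hvi : ∀ e, v i e = 0 := fun e => le_antisymm (by simpa [hi] using hcost i e) (hv i e)
    refine ⟨fun _ => i, fun j => ?_⟩
    have hle : cost (v j) (fun _ => i) j ≤ 0 := by
      rcases eq_or_ne i j with rfl | hij
      · simp [cost, hvi]
      · simp [cost, hij]
    rw [hWMMS]
    have := hc0 j
    have := hw j
    exact hle.trans (by positivity)
  push Not at hzero
  have hcpos : ∀ i, 0 < c i := fun i => (hc0 i).lt_of_ne (hzero i).symm
  obtain ⟨i₀, -, hmax⟩ := exists_max_image (univ : Finset (Fin n)) w univ_nonempty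
  set W := w i₀
  have hW : 0 < W := hw i₀
  have hround : ∀ i, ∃ p : ℕ, w i ≤ W / 2 ^ p ∧ W / 2 ^ p ≤ 2 * w i ∧ (i = i₀ → p = 0) := by
    intro i
    by_cases hi : i = i₀
    · exact ⟨0, by simp [hi, W], by subst hi; simp only [pow_zero, div_one]; linarith,
        fun _ => rfl⟩
    · obtain ⟨p, h1, h2⟩ := exists_pow_round (hw i) (hmax i (mem_univ i))
      refine ⟨p, h2, ?_, fun h => absurd h hi⟩
      rw [pow_succ, ← div_div] at h1
      linarith
  choose p hp1 hp2 hp0 using hround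
  have hscaled : ∀ i e, v i e / c i ≤ w (f i e) := fun i e =>
    (div_le_iff₀' (hcpos i)).2 (hcost i e)
  choose q hq hqlt using fun i => exists_round_items (W := W) (fun e => v i e / c i)
    (fun e => div_nonneg (hv i e) (hc0 i)) (fun e => (hscaled i e).trans (hmax _ (mem_univ _)))
    (f i) (fun j => W / 2 ^ p j) (fun j => by positivity) (fun j => by
      refine le_trans ?_ (hp1 j)
      simp only [cost, ← sum_div]
      exact (div_le_iff₀' (hcpos i)).2 (hf i j))
  choose k Q hk hgap using fun i j => exists_dyadic_gap hW _ (q i) (p j) (hqlt i j)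
  choose q' g' hfill using fun i => exists_filling W (k i) (Q i) (hk i)
    (K := ∑ i, ∑ j, k i j) (single_le_sum (f := fun i => ∑ j, k i j)
      (fun _ _ => Nat.zero_le _) (mem_univ i))
  obtain ⟨h, hh⟩ := exists_cost_le_of_perfect α hcanonical hW p ⟨i₀, hp0 i₀ rfl⟩
    (fun i => Sum.elim (q i) (q' i)) (fun i => Sum.elim (f i) (g' i)) (fun i j => by
      rw [cost_sumType]
      refine (congrArg₂ (· + ·) rfl ((hfill i j).trans (hgap i j).symm)).trans ?_
      exact add_sub_cancel _ _)
  refine ⟨h ∘ Sum.inl, fun i => ?_⟩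
  have hi := hh i
  rw [cost_sumType] at hi
  have hdummy : 0 ≤ cost ((fun e => W / 2 ^ Sum.elim (q i) (q' i) e) ∘ Sum.inr)
      (h ∘ Sum.inr) i := sum_nonneg fun e _ => by simp only [Function.comp]; positivity
  have horig : cost (v i) (h ∘ Sum.inl) i ≤
      2 * c i * cost ((fun e => W / 2 ^ Sum.elim (q i) (q' i) e) ∘ Sum.inl) (h ∘ Sum.inl) i := by
    simp only [cost, mul_sum]
    refine sum_le_sum fun e _ => ?_
    have := (div_le_iff₀' (hcpos i)).1 (hq i e)
    exact this.trans_eq (by simp only [Function.comp, Sum.elim_inl]; ring)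
  have h2 : α * (W / 2 ^ p i) ≤ α * (2 * w i) :=
    mul_le_mul_of_nonneg_left (hp2 i) (zero_le_one.trans hα)
  calc cost (v i) (h ∘ Sum.inl) i ≤ _ := horig
    _ ≤ 2 * c i * (α * (2 * w i)) :=
      mul_le_mul_of_nonneg_left (by linarith) (by have := hc0 i; positivity)
    _ = 4 * α * WMMS w (v i) i := by rw [hWMMS]; ring

end Chores
end

section
/- Every canonical chore instance admits a 3-WMMS allocation; that is, there exists an allocation (A_1,…,A_n) with v_i(A_i) ≤ 3·w_i (= 3·WMMS_i) for every agent i. -/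
open Finset

namespace Chores

/-- The load of agent `i` from the first `t` items when item `e` is given to agent `g e`. -/
noncomputable def load {n : ℕ} (V : Fin n → ℕ → ℝ) (g : ℕ → Fin n) (i : Fin n) (t : ℕ) : ℝ :=
  ∑ e ∈ range t, if g e = i then V i e else 0

/-- Agent `i` may receive item `e`: the item costs at most `w i`, and the load of `i` from the
earlier items is below `3 * w i`. -/
def Available {n : ℕ} (w : Fin n → ℝ) (V : Fin n → ℕ → ℝ) (g : ℕ → Fin n) (e : ℕ)
    (i : Fin n) : Prop :=
  V i e ≤ w i ∧ load V g i e < 3 * w i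

/-- Item `e` goes to an available agent of least cost, and agents of larger index that are
available have at least twice that cost. -/
def GreedyAt {n : ℕ} (w : Fin n → ℝ) (V : Fin n → ℕ → ℝ) (g : ℕ → Fin n) (e : ℕ) : Prop :=
  Available w V g e (g e) ∧ ∀ k, Available w V g e k →
    V (g e) e ≤ V k e ∧ (g e < k → 2 * V (g e) e ≤ V k e)

/-- The properties of a canonical instance used by the greedy allocation; the items are the
natural numbers below `m`. -/
structure DyadicInstance {n : ℕ} (m : ℕ) (w : Fin n → ℝ) (V : Fin n → ℕ → ℝ) : Prop where
  weight_pos : ∀ i, 0 < w i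
  cost_pos : ∀ i, ∀ e < m, 0 < V i e
  antitone : ∀ i e e', e ≤ e' → e' < m → V i e' ≤ V i e
  sum_weight : ∑ i, w i = 1
  prefix_le_one : ∀ i, ∀ t ≤ m, ∑ e ∈ range t, V i e ≤ 1
  prefix_le : ∀ i a, ∀ t ≤ m, ∑ e ∈ range t, V i e ≤ ∑ j ∈ Iio a, w j + t * w a
  count_le : ∀ a, ∀ t ≤ m, (∀ e < t, w a < V a e) → t * (2 * w a) ≤ ∑ j ∈ Iio a, w j
  double_le : ∀ i k, ∀ e < m, V i e < V k e → 2 * V i e ≤ V k e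
  cost_dvd : ∀ i e e', e ≤ e' → e' < m → ∃ c : ℕ, V i e = c * V i e'
  weight_dvd : ∀ i, ∀ e < m, V i e ≤ w i → ∃ c : ℕ, w i = c * V i e

section Greedy

variable {n m : ℕ} {w : Fin n → ℝ} {V : Fin n → ℕ → ℝ} {g : ℕ → Fin n}

lemma load_congr {g' : ℕ → Fin n} {t : ℕ} (h : ∀ e < t, g e = g' e) (i : Fin n) :
    load V g i t = load V g' i t := by
  refine sum_congr rfl fun e he => ?_
  rw [h e (mem_range.1 he)]

lemma greedyAt_congr {g' : ℕ → Fin n} {t : ℕ} (h : ∀ e ≤ t, g e = g' e)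
    (hg : GreedyAt w V g t) : GreedyAt w V g' t := by
  have hl : ∀ i, load V g i t = load V g' i t := load_congr fun e he => h e he.le
  simpa only [GreedyAt, Available, hl, h t le_rfl] using hg

lemma sum_load (A : Finset (Fin n)) (t : ℕ) :
    ∑ j ∈ A, load V g j t = ∑ e ∈ range t, if g e ∈ A then V (g e) e else 0 := by
  unfold load
  rw [sum_comm]
  exact sum_congr rfl fun e _ => sum_ite_eq A (g e) fun j => V j e

lemma sum_load_univ (t : ℕ) :
    ∑ j, load V g j t = ∑ e ∈ range t, V (g e) e := by
  simp [sum_load]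

namespace DyadicInstance

variable (H : DyadicInstance m w V)
include H

lemma load_mono (i : Fin n) {t t' : ℕ} (h : t ≤ t') (ht' : t' ≤ m) :
    load V g i t ≤ load V g i t' := by
  refine sum_le_sum_of_subset_of_nonneg (range_mono h) fun e he _ => ?_
  split_ifs
  · exact (H.cost_pos i e (by have := mem_range.1 he; omega)).le
  · exact le_rfl

lemma load_nonneg (i : Fin n) {t : ℕ} (ht : t ≤ m) : 0 ≤ load V g i t := by
  simpa [load] using H.load_mono (g := g) i (Nat.zero_le t) ht

lemma prefix_le_of_costly (i a : Fin n) {t : ℕ} (ht : t ≤ m) (h : ∀ e < t, w a < V a e) :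
    ∑ e ∈ range t, V i e ≤ 3 / 2 * ∑ j ∈ Iio a, w j := by
  linarith [H.prefix_le i a t ht, H.count_le a t ht h]

/-- If the total load of the first `t` items is at most their total cost for some agent, then
the first agent of load less than `3 * w b` is available for the next item. -/
lemma exists_available {t : ℕ} (ht : t < m) {k : Fin n}
    (hk : ∑ e ∈ range t, V (g e) e ≤ ∑ e ∈ range t, V k e) :
    ∃ b, Available w V g t b ∧ ∀ j < b, 3 * w j ≤ load V g j t := by
  have hex : ∃ j, load V g j t < 3 * w j := by
    by_contra! hcon
    have h1 : ∑ j, 3 * w j ≤ ∑ j, load V g j t := sum_le_sum fun j _ => hcon j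
    rw [← mul_sum, H.sum_weight, sum_load_univ] at h1
    linarith [H.prefix_le_one k t ht.le]
  obtain ⟨b, hb, hmin⟩ := wellFounded_lt.has_min {j | load V g j t < 3 * w j} hex
  have hlow : ∀ j < b, 3 * w j ≤ load V g j t := fun j hj => by
    by_contra! hcon
    exact hmin j hcon hj
  refine ⟨b, ⟨?_, hb⟩, hlow⟩
  by_contra! hcon
  have hall : ∀ e < t + 1, w b < V b e := fun e he =>
    hcon.trans_le (H.antitone b e t (by omega) ht)
  have h1 := H.count_le b (t + 1) ht hall
  have h2 := H.prefix_le_of_costly k b ht.le fun e he => hall e (by omega)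
  have h3 : ∑ j ∈ Iio b, 3 * w j ≤ ∑ j ∈ Iio b, load V g j t :=
    sum_le_sum fun j hj => hlow j (mem_Iio.1 hj)
  have h4 : ∑ j ∈ Iio b, load V g j t ≤ ∑ j, load V g j t :=
    sum_le_sum_of_subset_of_nonneg (subset_univ _) fun j _ _ => H.load_nonneg j ht.le
  rw [sum_load_univ] at h4
  rw [← mul_sum] at h3
  have h5 : 0 < ((t + 1 : ℕ) : ℝ) * (2 * w b) := by
    have := H.weight_pos b
    positivity
  linarith

/-- In a greedy allocation, the total load of the first `t` items is at most the total cost of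
these items for some agent. -/
lemma exists_total_load_le [NeZero n] {t : ℕ} (ht : t ≤ m) (hg : ∀ e < t, GreedyAt w V g e) :
    ∃ k, ∑ e ∈ range t, V (g e) e ≤ ∑ e ∈ range t, V k e := by
  classical
  induction t using Nat.strong_induction_on with
  | _ t ih =>
  obtain rfl | ⟨t, rfl⟩ : t = 0 ∨ ∃ s, t = s + 1 := by
    cases t <;> simp
  · exact ⟨0, by simp⟩
  obtain ⟨k, hk⟩ := ih t (by omega) (by omega) fun e he => hg e (by omega)
  obtain ⟨b, hb, hlow⟩ := H.exists_available (by omega) hk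
  have hex : ∃ e, V b e ≤ w b := ⟨t, hb.1⟩
  obtain ⟨s, hs, hsmin⟩ : ∃ s, V b s ≤ w b ∧ ∀ e < s, w b < V b e :=
    ⟨Nat.find hex, Nat.find_spec hex, fun e he => not_le.1 (Nat.find_min hex he)⟩
  have hst : s ≤ t := by
    by_contra! hcon
    exact absurd hb.1 (not_le.2 (hsmin t hcon))
  obtain ⟨k', hk'⟩ := ih s (by omega) (by omega) fun e he => hg e (by omega)
  have hSs := hk'.trans (H.prefix_le_of_costly k' b (by omega) hsmin)
  have hnonneg : ∀ e < t + 1, 0 ≤ V (g e) e := fun e he =>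
    (H.cost_pos _ e (by omega)).le
  refine ⟨b, ?_⟩
  have hitem : ∀ e ∈ Ico s (t + 1),
      V (g e) e + (if g e ∈ Iio b then V (g e) e else 0) ≤ V b e := by
    intro e he
    rw [mem_Ico] at he
    have hav : Available w V g e b :=
      ⟨(H.antitone b s e he.1 (by omega)).trans hs,
        (H.load_mono b (show e ≤ t by omega) (by omega)).trans_lt hb.2⟩
    obtain ⟨h1, h2⟩ := (hg e he.2).2 b hav
    split_ifs with hlt
    · linarith [h2 (mem_Iio.1 hlt)]
    · linarith
  have hsum := sum_le_sum hitem
  rw [sum_add_distrib, sum_Ico_eq_sub _ (by omega), sum_Ico_eq_sub _ (by omega),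
    sum_Ico_eq_sub _ (by omega), ← sum_load, ← sum_load] at hsum
  have hMs : 0 ≤ ∑ e ∈ range s, V b e := sum_nonneg fun e he =>
    (H.cost_pos b e (by have := mem_range.1 he; omega)).le
  have hlow_s : ∑ j ∈ Iio b, load V g j s ≤ ∑ e ∈ range s, V (g e) e := by
    rw [← sum_load_univ]
    exact sum_le_sum_of_subset_of_nonneg (subset_univ _) fun j _ _ =>
      H.load_nonneg j (by omega)
  have hlow_t : 3 * ∑ j ∈ Iio b, w j ≤ ∑ j ∈ Iio b, load V g j (t + 1) := by
    rw [mul_sum]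
    exact sum_le_sum fun j hj => (hlow j (mem_Iio.1 hj)).trans
      (H.load_mono j (by omega) ht)
  linarith

lemma exists_greedy [NeZero n] {t : ℕ} (ht : t ≤ m) :
    ∃ g : ℕ → Fin n, ∀ e < t, GreedyAt w V g e := by
  classical
  induction t with
  | zero => exact ⟨fun _ => 0, fun e he => absurd he (Nat.not_lt_zero e)⟩
  | succ t ih =>
  obtain ⟨g, hg⟩ := ih (by omega)
  obtain ⟨k, hk⟩ := H.exists_total_load_le (by omega) hg
  obtain ⟨b, hb, -⟩ := H.exists_available ht hk
  obtain ⟨i, hi, hmin⟩ := exists_min_image (univ.filter (Available w V g t)) (fun i => V i t)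
    ⟨b, by simpa using hb⟩
  obtain ⟨c, hc, hmax⟩ := exists_max_image
    (univ.filter fun j => Available w V g t j ∧ V j t = V i t) id
    ⟨i, by simpa using hi⟩
  simp only [mem_filter, mem_univ, true_and, id] at hi hmin hc hmax
  have hupd : ∀ e < t, g e = Function.update g t c e := fun e he =>
    (Function.update_of_ne he.ne _ _).symm
  refine ⟨Function.update g t c, fun e he => ?_⟩
  obtain he | rfl : e < t ∨ e = t := by omega
  · exact greedyAt_congr (fun e' he' => hupd e' (by omega)) (hg e he)
  have hl : ∀ j, load V (Function.update g e c) j e = load V g j e := fun j =>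
    (load_congr hupd j).symm
  simp only [GreedyAt, Available, hl, Function.update_self]
  refine ⟨hc.1, fun k hk => ⟨hc.2.trans_le (hmin k hk), fun hck => ?_⟩⟩
  refine H.double_le c k e ht (lt_of_le_of_ne (hc.2.trans_le (hmin k hk)) fun heq => ?_)
  exact absurd hck (not_lt.2 (hmax k ⟨hk, heq.symm.trans hc.2⟩))

lemma load_dvd (i : Fin n) {t s : ℕ} (hts : t ≤ s) (hs : s < m) :
    ∃ c : ℕ, load V g i t = c * V i s := by
  induction t with
  | zero => exact ⟨0, by simp [load]⟩
  | succ t ih =>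
    obtain ⟨c, hc⟩ := ih (by omega)
    obtain ⟨d, hd⟩ := H.cost_dvd i t s (by omega) hs
    unfold load at hc ⊢
    rw [sum_range_succ, hc]
    split_ifs
    · exact ⟨c + d, by rw [hd]; push_cast; ring⟩
    · exact ⟨c, by ring⟩

lemma load_le {t : ℕ} (ht : t ≤ m) (hg : ∀ e < t, GreedyAt w V g e) (i : Fin n) :
    load V g i t ≤ 3 * w i := by
  induction t with
  | zero => simpa [load] using (H.weight_pos i).le
  | succ t ih =>
    have hih := ih (by omega) fun e he => hg e (by omega)
    have hsucc : load V g i (t + 1) = load V g i t + if g t = i then V i t else 0 :=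
      sum_range_succ _ _
    rw [hsucc]
    split_ifs with hgi
    · obtain ⟨hcost, hlt⟩ := (hg t (by omega)).1
      rw [hgi] at hcost hlt
      obtain ⟨c, hc⟩ := H.load_dvd (g := g) i le_rfl ht
      obtain ⟨d, hd⟩ := H.weight_dvd i t ht hcost
      have hpos := H.cost_pos i t ht
      rw [hc] at hlt ⊢
      rw [hd, ← mul_assoc] at hlt ⊢
      have h1 : (c : ℝ) < 3 * d := lt_of_mul_lt_mul_right hlt hpos.le
      have h2 : (c : ℝ) + 1 ≤ 3 * d := by
        have : c < 3 * d := by exact_mod_cast h1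
        exact_mod_cast this
      nlinarith
    · simpa using hih

end DyadicInstance

end Greedy

lemma two_mul_le_of_dyadic {c : ℝ} (hc : 0 < c) {p q : ℕ} (h : c / 2 ^ p < c / 2 ^ q) :
    2 * (c / 2 ^ p) ≤ c / 2 ^ q := by
  have hqp : q < p := by
    by_contra! hcon
    refine absurd h (not_lt.2 ?_)
    gcongr
    norm_num
  obtain ⟨d, rfl⟩ := Nat.exists_eq_add_of_lt hqp
  have : 2 * (c / 2 ^ (q + d + 1)) = c / 2 ^ (q + d) := by
    rw [pow_succ]
    field_simp
  rw [this]
  gcongr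
  · norm_num
  · omega

lemma exists_nat_mul_of_dyadic {c : ℝ} (hc : 0 < c) {p q : ℕ} (h : c / 2 ^ p ≤ c / 2 ^ q) :
    ∃ k : ℕ, c / 2 ^ q = k * (c / 2 ^ p) := by
  have hqp : q ≤ p := by
    by_contra! hcon
    refine absurd h (not_le.2 ?_)
    gcongr
    norm_num
  obtain ⟨d, rfl⟩ := Nat.exists_eq_add_of_le hqp
  refine ⟨2 ^ d, ?_⟩
  rw [pow_add]
  push_cast
  field_simp

/-- An agent whose weighted maximin share is at most her weight has an allocation giving every
agent `j` a bundle of cost at most `w j`. -/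
lemma exists_cost_le_of_WMMS_le {ι : Type*} [Fintype ι] {n : ℕ} [NeZero n] {w : Fin n → ℝ}
    (hw : ∀ i, 0 < w i) {v : ι → ℝ} {i : Fin n} (h : WMMS w v i ≤ w i) :
    ∃ f : ι → Fin n, ∀ j, cost v f j ≤ w j := by
  classical
  have h1 : (⨅ f : ι → Fin n, ⨆ j : Fin n, cost v f j / w j) ≤ 1 := by
    unfold WMMS at h
    exact le_of_mul_le_mul_left (by linarith) (hw i)
  obtain ⟨f, hf⟩ := exists_eq_ciInf_of_finite (f := fun f : ι → Fin n => ⨆ j, cost v f j / w j)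
  refine ⟨f, fun j => ?_⟩
  have h2 : cost v f j / w j ≤ 1 :=
    (le_ciSup (f := fun j => cost v f j / w j) (Set.finite_range _).bddAbove j).trans
      (hf.trans_le h1)
  exact (div_le_one (hw j)).1 h2

/-- If every agent `j` can be given a bundle of cost at most `w j`, then the items costing more
than `c` fit into the agents of weight more than `c`. -/
lemma sum_large_cost_le {ι : Type*} [Fintype ι] {n : ℕ} {w : Fin n → ℝ} {v : ι → ℝ}
    (hv : ∀ e, 0 ≤ v e) {f : ι → Fin n} (hf : ∀ j, cost v f j ≤ w j) (c : ℝ) :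
    ∑ e, (if c < v e then v e else 0) ≤ ∑ j ∈ univ.filter (fun j => c < w j), w j := by
  classical
  have hitem : ∀ e, v e ≤ w (f e) := fun e =>
    (single_le_sum (f := v) (fun e' _ => hv e') (by simp)).trans (hf (f e))
  calc ∑ e, (if c < v e then v e else 0)
      ≤ ∑ e, if c < w (f e) then v e else 0 := by
        refine sum_le_sum fun e _ => ?_
        split_ifs with h1 h2 h2
        · exact le_rfl
        · exact absurd (h1.trans_le (hitem e)) h2
        · exact hv e
        · exact le_rfl
    _ = ∑ j ∈ univ.filter (fun j => c < w j), cost v f j := by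
        rw [← sum_filter]
        unfold cost
        rw [← sum_fiberwise_of_maps_to (s := univ.filter fun e => c < w (f e))
          (t := univ.filter fun j => c < w j) (g := f) (by simp)]
        refine sum_congr rfl fun j hj => sum_congr ?_ fun _ _ => rfl
        ext e
        simp only [mem_filter, mem_univ, true_and] at hj ⊢
        exact ⟨fun h => h.2, fun h => ⟨h ▸ hj, h⟩⟩
    _ ≤ ∑ j ∈ univ.filter (fun j => c < w j), w j := sum_le_sum fun j _ => hf j

/-- A canonical instance, with its items listed as natural numbers. -/
lemma Canonical.dyadicInstance {n m : ℕ} [NeZero n] {w : Fin n → ℝ} {v : Fin n → Fin m → ℝ}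
    (hcan : Canonical w v) :
    DyadicInstance m w fun i e => if h : e < m then v i ⟨e, h⟩ else 0 := by
  obtain ⟨⟨hw, hv⟩, hanti, hsum, hwd, hone, hvd, hido, hW⟩ := hcan
  set V : Fin n → ℕ → ℝ := fun i e => if h : e < m then v i ⟨e, h⟩ else 0 with hV
  have hVeq : ∀ i e (h : e < m), V i e = v i ⟨e, h⟩ := fun i e h => dif_pos h
  have hVnonneg : ∀ i e, 0 ≤ V i e := fun i e => by
    simp only [hV]
    split_ifs
    · exact hv _ _
    · exact le_rfl
  have hdy : ∀ i, ∀ e < m, ∃ q : ℕ, V i e = w 0 / 2 ^ q := fun i e he => by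
    rw [hVeq i e he]
    exact hvd i _
  have hlarge : ∀ i a, ∑ e ∈ range m, (if w a < V i e then V i e else 0) ≤
      ∑ j ∈ Iio a, w j := by
    intro i a
    obtain ⟨f, hf⟩ := exists_cost_le_of_WMMS_le hw (hW i).le
    have h1 := sum_large_cost_le (hv i) hf (w a)
    rw [sum_range]
    simp only [hVeq _ _ (Fin.is_lt _)]
    refine h1.trans (sum_le_sum_of_subset_of_nonneg (fun j hj => ?_) fun j _ _ => (hw j).le)
    simp only [mem_filter, mem_univ, true_and] at hj
    rw [mem_Iio]
    by_contra! hcon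
    exact absurd hj (not_lt.2 (hanti a j hcon))
  have hlarge_prefix : ∀ i a, ∀ t ≤ m, ∑ e ∈ range t, (if w a < V i e then V i e else 0) ≤
      ∑ j ∈ Iio a, w j := fun i a t ht =>
    (sum_le_sum_of_subset_of_nonneg (range_mono ht) fun e _ _ => by
      split_ifs
      · exact hVnonneg i e
      · exact le_rfl).trans (hlarge i a)
  refine
    { weight_pos := hw
      cost_pos := fun i e he => ?_
      antitone := fun i e e' hee' he' => ?_
      sum_weight := hsum
      prefix_le_one := fun i t ht => ?_
      prefix_le := fun i a t ht => ?_
      count_le := fun a t ht h => ?_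
      double_le := fun i k e he h => ?_
      cost_dvd := fun i e e' hee' he' => ?_
      weight_dvd := fun i e he h => ?_ }
  · obtain ⟨q, hq⟩ := hdy i e he
    rw [hq]
    have := hw 0
    positivity
  · rw [hVeq i e' he', hVeq i e (by omega)]
    exact hido i _ _ hee'
  · refine (sum_le_sum_of_subset_of_nonneg (range_mono ht) fun e _ _ => hVnonneg i e).trans ?_
    rw [sum_range]
    simp only [hVeq _ _ (Fin.is_lt _)]
    exact (hone i).le
  · have h1 : ∑ e ∈ range t, V i e ≤
        ∑ e ∈ range t, ((if w a < V i e then V i e else 0) + w a) := by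
      refine sum_le_sum fun e _ => ?_
      split_ifs with h
      · linarith [hw a]
      · linarith
    rw [sum_add_distrib, sum_const, card_range, nsmul_eq_mul] at h1
    linarith [hlarge_prefix i a t ht]
  · have h1 : ∑ e ∈ range t, 2 * w a ≤ ∑ e ∈ range t, (if w a < V a e then V a e else 0) := by
      refine sum_le_sum fun e he => ?_
      have he := mem_range.1 he
      have hlt := h e he
      rw [if_pos hlt]
      obtain ⟨p, hp⟩ := hwd a
      obtain ⟨q, hq⟩ := hdy a e (by omega)
      rw [hp, hq] at hlt ⊢
      exact two_mul_le_of_dyadic (hw 0) hlt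
    rw [sum_const, card_range, nsmul_eq_mul] at h1
    exact h1.trans (hlarge_prefix a a t ht)
  · obtain ⟨p, hp⟩ := hdy i e he
    obtain ⟨q, hq⟩ := hdy k e he
    rw [hp, hq] at h ⊢
    exact two_mul_le_of_dyadic (hw 0) h
  · have hle : V i e' ≤ V i e := by
      rw [hVeq i e' he', hVeq i e (by omega)]
      exact hido i _ _ hee'
    obtain ⟨p, hp⟩ := hdy i e' he'
    obtain ⟨q, hq⟩ := hdy i e (by omega)
    rw [hp, hq] at hle ⊢
    exact exists_nat_mul_of_dyadic (hw 0) hle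
  · obtain ⟨p, hp⟩ := hdy i e he
    obtain ⟨q, hq⟩ := hwd i
    change V i e ≤ w i at h
    rw [hp, hq] at h ⊢
    exact exists_nat_mul_of_dyadic (hw 0) h

/-- Every canonical chore instance admits a 3-WMMS allocation:
there is an allocation `(A_1,…,A_n)` with `v_i(A_i) ≤ 3·w_i (= 3·WMMS_i)` for
every agent `i`. -/
theorem canonical_three_WMMS {n m : ℕ} [NeZero n]
    (w : Fin n → ℝ) (v : Fin n → Fin m → ℝ) (hcan : Canonical w v) :
    ∃ f : Fin m → Fin n, ∀ i : Fin n, cost (v i) f i ≤ 3 * w i := by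
  have H := hcan.dyadicInstance
  obtain ⟨g, hg⟩ := H.exists_greedy le_rfl
  refine ⟨fun e => g e, fun i => le_of_eq_of_le ?_ (H.load_le le_rfl hg i)⟩
  rw [cost, load, sum_range, sum_filter]
  simp

end Chores
end

section
/- In a canonical chore instance whose agents are grouped by weight into groups G_1,…,G_k, for every group index r ∈ [k], every agent a with valuation v, and every item index h with h > L_r (where L_1 = 0 and L_r = (Σ_{j<r} W_j)/w_r), it holds that v(e_h) ≤ w_r. -/
open Finset

namespace Chores

open scoped Classical in
/-- Grouping of the agents by weight: `gw r` is the common weight of the `gn r`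
agents forming group `r`, and the group weights are strictly decreasing. -/
def Grouping {n k : ℕ} (w : Fin n → ℝ) (gw : Fin k → ℝ) (gn : Fin k → ℕ) : Prop :=
  (∀ r s : Fin k, r < s → gw s < gw r) ∧
  (∀ i : Fin n, ∃ r : Fin k, w i = gw r) ∧
  (∀ r : Fin k, (univ.filter (fun i : Fin n => w i = gw r)).card = gn r) ∧
  (∀ r : Fin k, 0 < gn r)

/-- `L_r = (Σ_{j<r} W_j)/w_r` where `W_j = n_j·w_j` (and `L_1 = 0`). -/
noncomputable def Lr {k : ℕ} (gw : Fin k → ℝ) (gn : Fin k → ℕ) (r : Fin k) : ℝ :=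
  (∑ j ∈ univ.filter (fun j => j < r), (gn j : ℝ) * gw j) / gw r

/-- If the weighted maximin share of `i` equals her weight, then some allocation gives each
agent `j` a bundle of cost at most `w j`. -/
theorem exists_cost_le_weight {ι : Type*} [Fintype ι] {n : ℕ} {w : Fin n → ℝ} {v : ι → ℝ}
    (hw : ∀ j, 0 < w j) (i : Fin n) (hi : WMMS w v i = w i) :
    ∃ f : ι → Fin n, ∀ j, cost v f j ≤ w j := by
  have : Nonempty (ι → Fin n) := ⟨fun _ => i⟩
  obtain ⟨f, hf⟩ := exists_eq_ciInf_of_finite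
    (f := fun f : ι → Fin n => ⨆ j : Fin n, cost v f j / w j)
  refine ⟨f, fun j => ?_⟩
  have h1 : ⨆ j : Fin n, cost v f j / w j = 1 := by
    rw [hf]
    exact (mul_eq_left₀ (hw i).ne').mp hi
  have h2 : cost v f j / w j ≤ ⨆ j : Fin n, cost v f j / w j :=
    le_ciSup (f := fun j => cost v f j / w j) (Set.finite_range _).bddAbove j
  rwa [h1, div_le_one (hw j)] at h2

open scoped Classical in
/-- The agents heavier than group `r` have total weight `∑_{s < r} W_s`. -/
theorem sum_weight_heavier {n k : ℕ} {w : Fin n → ℝ} {gw : Fin k → ℝ} {gn : Fin k → ℕ}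
    (hg : Grouping w gw gn) (r : Fin k) :
    ∑ i with gw r < w i, w i = ∑ s with s < r, (gn s : ℝ) * gw s := by
  obtain ⟨hanti, hcover, hcard, -⟩ := hg
  have hanti : StrictAnti gw := fun r s => hanti r s
  choose g hgr using hcover
  have hfib : ∀ i ∈ univ.filter (fun i => gw r < w i), g i ∈ univ.filter (fun s => s < r) := by
    intro i hi
    simpa [hgr, hanti.lt_iff_gt] using hi
  rw [← sum_fiberwise_of_maps_to hfib]
  refine sum_congr rfl fun s hs => ?_
  have hs : s < r := by simpa using hs
  have hset : ({i ∈ univ.filter (fun i => gw r < w i) | g i = s}) =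
      univ.filter (fun i => w i = gw s) := by
    ext i
    simp only [mem_filter, mem_univ, true_and, hgr, hanti.injective.eq_iff, hanti.lt_iff_gt]
    exact ⟨fun h => h.2, fun h => ⟨h ▸ hs, h⟩⟩
  rw [hset, sum_congr rfl fun i hi => (mem_filter.mp hi).2, sum_const, hcard, nsmul_eq_mul]

open scoped Classical in
/-- If bundle `j` costs at most `w j` for every `j`, a set of items each costing more than `c`
has total cost at most the total weight of the agents heavier than `c`. -/
theorem sum_le_sum_weight_of_lt {ι : Type*} [Fintype ι] {n : ℕ} {w : Fin n → ℝ} {v : ι → ℝ}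
    (hv : ∀ e, 0 ≤ v e) {f : ι → Fin n} (hf : ∀ j, cost v f j ≤ w j) {c : ℝ} {S : Finset ι}
    (hS : ∀ e ∈ S, c < v e) :
    ∑ e ∈ S, v e ≤ ∑ j with c < w j, w j := by
  have hmaps : ∀ e ∈ S, f e ∈ univ.filter (fun j => c < w j) := by
    intro e he
    have h1 : v e ≤ cost v f (f e) :=
      single_le_sum (f := v) (fun e _ => hv e) (by simp)
    simpa using (hS e he).trans_le (h1.trans (hf _))
  rw [← sum_fiberwise_of_maps_to hmaps]
  refine sum_le_sum fun j _ => le_trans ?_ (hf j)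
  refine sum_le_sum_of_subset_of_nonneg (fun e he => ?_) fun e _ _ => hv e
  simpa using (mem_filter.mp he).2

/-- In a canonical chore instance with weight groups `G_1,…,G_k`
(group `r` consisting of `gn r` agents of common weight `gw r`), for every group
index `r`, every agent `i`, and every item whose (1-based) index exceeds `L_r`, the
agent's cost for that item is at most `w_r`. -/
theorem item_after_Lr_small {n m k : ℕ} [NeZero n]
    (w : Fin n → ℝ) (v : Fin n → Fin m → ℝ) (gw : Fin k → ℝ) (gn : Fin k → ℕ)
    (hcan : Canonical w v) (hg : Grouping w gw gn)
    (r : Fin k) (i : Fin n) (h : Fin m)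
    (hh : Lr gw gn r < (h : ℕ) + 1) :
    v i h ≤ gw r := by
  classical
  obtain ⟨⟨hw, hv⟩, -, -, -, -, -, hmono, hwm⟩ := hcan
  by_contra! hlt
  obtain ⟨f, hf⟩ := exists_cost_le_weight hw i (hwm i)
  have hge : ∀ e ∈ Iic h, v i h ≤ v i e := fun e he => hmono i e h (mem_Iic.mp he)
  have hle := sum_le_sum_weight_of_lt (hv i) hf fun e he => hlt.trans_le (hge e he)
  rw [sum_weight_heavier hg r] at hle
  have hcard := card_nsmul_le_sum _ _ _ hge
  rw [Fin.card_Iic, nsmul_eq_mul, Nat.cast_add_one] at hcard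
  have hpos : 0 < gw r := by
    obtain ⟨j, hj⟩ := card_pos.mp (hg.2.2.1 r ▸ hg.2.2.2 r)
    exact (mem_filter.mp hj).2 ▸ hw j
  rw [Lr, div_lt_iff₀ hpos] at hh
  have : ((h : ℕ) + 1 : ℝ) * gw r ≤ ((h : ℕ) + 1 : ℝ) * v i h := by gcongr
  have hsum : ∑ s with s < r, (gn s : ℝ) * gw s < ((h : ℕ) + 1 : ℝ) * gw r := by
    convert hh
  linarith

end Chores
end

section
/- Let w > 0 and let o_1 ≥ o_2 ≥ … ≥ o_t be positive reals such that each o_h = w/2^{p_h} for some nonnegative integer p_h. Suppose that for every h ∈ [t], Σ_{s=1}^{h−1} o_s < 3w. Then for every h ∈ [t], the quantity (3w − Σ_{s=1}^{h} o_s)/o_h is a nonnegative integer; in particular Σ_{s=1}^{t} o_s ≤ 3w. -/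
open Finset

namespace Chores

/-- If `w / 2 ^ p ≤ w / 2 ^ q`, then `w / 2 ^ q` is a natural multiple of `w / 2 ^ p`. -/
theorem exists_nat_mul_of_div_two_pow_le {w : ℝ} (hw : 0 < w) {p q : ℕ}
    (h : w / 2 ^ p ≤ w / 2 ^ q) : ∃ m : ℕ, w / 2 ^ q = (m : ℝ) * (w / 2 ^ p) := by
  have hpow : (2 : ℝ) ^ q ≤ 2 ^ p :=
    (div_le_div_iff_of_pos_left hw (by positivity) (by positivity)).1 h
  obtain ⟨k, rfl⟩ := Nat.exists_eq_add_of_le ((pow_le_pow_iff_right₀ one_lt_two).1 hpow)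
  refine ⟨2 ^ k, ?_⟩
  push_cast
  field_simp
  ring

/-- A finite sum of natural multiples of `a` is a natural multiple of `a`. -/
theorem exists_nat_sum_eq_mul {ι : Type*} (s : Finset ι) (f : ι → ℝ) (a : ℝ)
    (h : ∀ i ∈ s, ∃ m : ℕ, f i = (m : ℝ) * a) : ∃ m : ℕ, ∑ i ∈ s, f i = (m : ℝ) * a := by
  choose! m hm using h
  refine ⟨∑ i ∈ s, m i, ?_⟩
  rw [sum_congr rfl hm, ← sum_mul, Nat.cast_sum]

/-- Let `w > 0` and let `o_1 ≥ o_2 ≥ … ≥ o_t` be positive reals,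
each of the form `w/2^p` for a nonnegative integer `p`. If for every `h ∈ [t]` the
partial sum `Σ_{s=1}^{h−1} o_s` is `< 3w`, then for every `h ∈ [t]` the quantity
`(3w − Σ_{s=1}^{h} o_s)/o_h` is a nonnegative integer; in particular
`Σ_{s=1}^{t} o_s ≤ 3w`. -/
theorem exact_exit_arithmetic (w : ℝ) (hw : 0 < w) (t : ℕ) (o : Fin t → ℝ)
    (hmono : ∀ h h' : Fin t, h ≤ h' → o h' ≤ o h)
    (hpow : ∀ h : Fin t, ∃ p : ℕ, o h = w / 2 ^ p)
    (hlt : ∀ h : Fin t, ∑ s ∈ univ.filter (fun s => s < h), o s < 3 * w) :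
    (∀ h : Fin t, ∃ q : ℕ,
      3 * w - ∑ s ∈ univ.filter (fun s => s ≤ h), o s = (q : ℝ) * o h) ∧
    ∑ s, o s ≤ 3 * w := by
  have key : ∀ h : Fin t, ∃ q : ℕ,
      3 * w - ∑ s ∈ univ.filter (fun s => s ≤ h), o s = (q : ℝ) * o h := by
    intro h
    obtain ⟨p, hp⟩ := hpow h
    have hpos : 0 < o h := by rw [hp]; positivity
    obtain ⟨N, hN⟩ := exists_nat_sum_eq_mul (univ.filter (fun s => s < h)) o (o h) (by
      intro s hs
      obtain ⟨r, hr⟩ := hpow s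
      have hle := hmono s h (mem_filter.1 hs).2.le
      rw [hp, hr] at hle ⊢
      exact exists_nat_mul_of_div_two_pow_le hw hle)
    have hw3 : 3 * w = ((3 * 2 ^ p : ℕ) : ℝ) * o h := by
      rw [hp]
      push_cast
      field_simp
    have hsum : ∑ s ∈ univ.filter (fun s => s ≤ h), o s =
        o h + ∑ s ∈ univ.filter (fun s => s < h), o s := by
      rw [← sum_insert (by simp)]
      congr 1
      ext s
      simp [le_iff_eq_or_lt]
    have hlt' := hlt h
    rw [hN, hw3] at hlt'
    have hNlt : N < 3 * 2 ^ p := by exact_mod_cast lt_of_mul_lt_mul_right hlt' hpos.le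
    obtain ⟨q, hq⟩ := Nat.exists_eq_add_of_lt hNlt
    refine ⟨q, ?_⟩
    rw [hsum, hN, hw3, hq]
    push_cast
    ring
  refine ⟨key, ?_⟩
  cases t with
  | zero => simpa using hw.le
  | succ n =>
    obtain ⟨q, hq⟩ := key (Fin.last n)
    obtain ⟨p, hp⟩ := hpow (Fin.last n)
    have hnonneg : 0 ≤ (q : ℝ) * o (Fin.last n) := by rw [hp]; positivity
    rw [filter_true_of_mem fun s _ => Fin.le_last s] at hq
    linarith

end Chores
end

section
/- Let a chore instance have weights w_1,…,w_n and let w'_1,…,w'_n be positive weights with w_j ≤ w'_j for all j (the valuations unchanged). Then for every agent i, the weighted maximin share of agent i computed with weights w' satisfies WMMS_i(w') ≤ (w'_i/w_i)·WMMS_i(w). In particular, if moreover w'_i < 2·w_i, then WMMS_i(w') ≤ 2·WMMS_i(w). -/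
open Finset

namespace Chores

theorem cost_nonneg {ι : Type*} [Fintype ι] {n : ℕ} {v : ι → ℝ} (hv : ∀ e, 0 ≤ v e)
    (f : ι → Fin n) (j : Fin n) : 0 ≤ cost v f j :=
  sum_nonneg fun e _ => hv e

theorem WMMS_nonneg {ι : Type*} [Fintype ι] {n : ℕ} {w : Fin n → ℝ} {v : ι → ℝ}
    (hw : ∀ j, 0 < w j) (hv : ∀ e, 0 ≤ v e) (i : Fin n) : 0 ≤ WMMS w v i :=
  mul_nonneg (hw i).le <| Real.iInf_nonneg fun f => Real.iSup_nonneg fun j =>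
    div_nonneg (cost_nonneg hv f j) (hw j).le

/-- The optimal maximum weighted load is antitone in the weights. -/
theorem iInf_iSup_cost_div_anti {ι : Type*} [Fintype ι] {n : ℕ} {w w' : Fin n → ℝ}
    {v : ι → ℝ} (hw : ∀ j, 0 < w j) (hle : ∀ j, w j ≤ w' j) (hv : ∀ e, 0 ≤ v e) :
    ⨅ f : ι → Fin n, ⨆ j : Fin n, cost v f j / w' j ≤
      ⨅ f : ι → Fin n, ⨆ j : Fin n, cost v f j / w j :=
  ciInf_mono (Set.finite_range _).bddBelow fun f =>
    ciSup_mono (Set.finite_range _).bddAbove fun j =>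
      div_le_div_of_nonneg_left (cost_nonneg hv f j) (hw j) (hle j)

/-- If `w'_j ≥ w_j > 0` for all `j` (valuations unchanged), then
for every agent `i` the WMMS computed with weights `w'` satisfies
`WMMS_i(w') ≤ (w'_i/w_i)·WMMS_i(w)`; in particular, if moreover `w'_i < 2·w_i`
then `WMMS_i(w') ≤ 2·WMMS_i(w)`. -/
theorem WMMS_weight_increase {n m : ℕ} (w w' : Fin n → ℝ) (v : Fin n → Fin m → ℝ)
    (hI : ChoreInstance w v) (hw' : ∀ j, 0 < w' j) (hle : ∀ j, w j ≤ w' j)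
    (i : Fin n) :
    WMMS w' (v i) i ≤ (w' i / w i) * WMMS w (v i) i ∧
    (w' i < 2 * w i → WMMS w' (v i) i ≤ 2 * WMMS w (v i) i) := by
  obtain ⟨hw, hv⟩ := hI
  have key : WMMS w' (v i) i ≤ (w' i / w i) * WMMS w (v i) i := by
    unfold WMMS
    rw [← mul_assoc, div_mul_cancel₀ _ (hw i).ne']
    exact mul_le_mul_of_nonneg_left (iInf_iSup_cost_div_anti hw hle (hv i)) (hw' i).le
  refine ⟨key, fun h => key.trans ?_⟩
  exact mul_le_mul_of_nonneg_right ((div_le_iff₀ (hw i)).2 h.le) (WMMS_nonneg hw (hv i) i)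

end Chores
end

section
/- Let I = (N, M, w, v) be a chore instance in which the weights satisfy w_1 ≥ … ≥ w_n, each w_i = w_1/2^p for some nonnegative integer p, Σ_i w_i = 1, and moreover v_i(M) = 1 and WMMS_i = w_i for every agent i. Then there exist a finite set M⁴ disjoint from M and an instance I' = (N, M ∪ M⁴, w, v') such that: (a) every item cost v'_i(e) is either 0 or of the form w_1/2^q for a nonnegative integer q; (b) for every e ∈ M with v_i(e) > 0, v_i(e)/2 < v'_i(e) ≤ v_i(e), and v'_i(e) = 0 whenever v_i(e) = 0; (c) v'_i(M ∪ M⁴) = v_i(M) = 1 for every agent i; and (d) WMMS_i(I') = WMMS_i(I) = w_i for every agent i. -/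
open Finset

namespace Chores

/-- When weights and costs have equal total, some bundle costs at least its weight. -/
theorem one_le_iSup_cost_div {ι : Type*} [Fintype ι] {n : ℕ} [NeZero n] {w : Fin n → ℝ}
    {v : ι → ℝ} (hw : ∀ j, 0 < w j) (hsum : ∑ e, v e = ∑ j, w j) (f : ι → Fin n) :
    1 ≤ ⨆ j : Fin n, cost v f j / w j := by
  obtain ⟨j, -, hj⟩ : ∃ j ∈ univ, w j ≤ cost v f j :=
    Finset.exists_le_of_sum_le univ_nonempty (by rw [sum_cost, hsum])
  exact ((one_le_div (hw j)).2 hj).trans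
    (le_ciSup (f := fun j => cost v f j / w j) (Set.finite_range _).bddAbove j)

/-- When weights and costs have equal total, the share of an agent equals its weight exactly
when the items can be split into bundles whose costs are the weights. -/
theorem WMMS_eq_weight_iff {ι : Type*} [Fintype ι] {n : ℕ} [NeZero n] {w : Fin n → ℝ}
    {v : ι → ℝ} (hw : ∀ j, 0 < w j) (hsum : ∑ e, v e = ∑ j, w j) (i : Fin n) :
    WMMS w v i = w i ↔ ∃ f : ι → Fin n, ∀ j, cost v f j = w j := by
  classical
  unfold WMMS
  rw [mul_eq_left₀ (hw i).ne']
  constructor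
  · intro h
    obtain ⟨f, hf⟩ := exists_eq_ciInf_of_finite (f := fun f : ι → Fin n => ⨆ j, cost v f j / w j)
    refine ⟨f, ?_⟩
    have hle : ∀ j ∈ univ, cost v f j ≤ w j := fun j _ => by
      rw [← div_le_one (hw j), ← h, ← hf]
      exact le_ciSup (f := fun j => cost v f j / w j) (Set.finite_range _).bddAbove j
    have := (Finset.sum_eq_sum_iff_of_le hle).1 (by rw [sum_cost, hsum])
    exact fun j => this j (mem_univ j)
  · rintro ⟨f, hf⟩
    refine le_antisymm ?_ (le_ciInf (one_le_iSup_cost_div hw hsum))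
    refine (ciInf_le (Set.finite_range _).bddBelow f).trans (ciSup_le fun j => ?_)
    rw [hf, div_self (hw j).ne']

/-- A nonnegative real `x ≤ a` can be rounded down to `0` or to some `a / 2 ^ q`, losing less
than half of its value when it is positive. -/
theorem exists_round_down {a x : ℝ} (hx : 0 ≤ x) (hxa : x ≤ a) :
    ∃ (r : ℝ) (q : ℕ), (r = 0 ∨ r = a / 2 ^ q) ∧ (0 < x → x / 2 < r ∧ r ≤ x) ∧
      (x = 0 → r = 0) := by
  classical
  rcases hx.eq_or_lt with rfl | hx
  · exact ⟨0, 0, by simp⟩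
  have hex : ∃ q : ℕ, a / 2 ^ q ≤ x := by
    obtain ⟨q, hq⟩ := pow_unbounded_of_one_lt (a / x) (one_lt_two (α := ℝ))
    refine ⟨q, ?_⟩
    rw [div_lt_iff₀ hx] at hq
    rw [div_le_iff₀ (by positivity)]
    linarith
  refine ⟨a / 2 ^ Nat.find hex, Nat.find hex, Or.inr rfl,
    fun _ => ⟨?_, Nat.find_spec hex⟩, fun h => absurd h hx.ne'⟩
  rcases hq : Nat.find hex with _ | k
  · rw [pow_zero, div_one]
    linarith
  · have hk : x < a / 2 ^ k := not_le.1 (Nat.find_min hex (by omega))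
    rw [pow_succ, ← div_div]
    linarith

theorem div_two_pow_mem_zmultiples (a : ℝ) {q Q : ℕ} (h : q ≤ Q) :
    a / 2 ^ q ∈ AddSubgroup.zmultiples (a / 2 ^ Q) := by
  obtain ⟨d, rfl⟩ := Nat.exists_eq_add_of_le h
  refine AddSubgroup.mem_zmultiples_iff.2 ⟨2 ^ d, ?_⟩
  rw [zsmul_eq_mul]
  push_cast
  field_simp
  ring

/-- Let `I = (N, M, w, v)` be a chore instance whose weights are
nonincreasing, each of the form `w_1/2^p`, and sum to `1`, and with `v_i(M) = 1`
and `WMMS_i = w_i` for every agent. Then there is a finite set `M⁴` of extra items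
(disjoint from `M`, modeled by the sum type `Fin m ⊕ Fin m₄`) and an instance
`I' = (N, M ∪ M⁴, w, v')` such that: (a) every item cost `v'_i(e)` is `0` or of the
form `w_1/2^q`; (b) for every `e ∈ M`, if `v_i(e) > 0` then
`v_i(e)/2 < v'_i(e) ≤ v_i(e)`, and `v'_i(e) = 0` whenever `v_i(e) = 0`;
(c) `v'_i(M ∪ M⁴) = v_i(M) = 1` for every agent; and
(d) `WMMS_i(I') = WMMS_i(I) = w_i` for every agent. -/
theorem round_down_values {n m : ℕ} [NeZero n]
    (w : Fin n → ℝ) (v : Fin n → Fin m → ℝ) (hI : ChoreInstance w v)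
    (hmono : ∀ i j : Fin n, i ≤ j → w j ≤ w i)
    (hpow : ∀ i : Fin n, ∃ p : ℕ, w i = w 0 / 2 ^ p)
    (hwsum : ∑ i, w i = 1)
    (hvsum : ∀ i : Fin n, ∑ e, v i e = 1)
    (hwmms : ∀ i : Fin n, WMMS w (v i) i = w i) :
    ∃ (m₄ : ℕ) (v' : Fin n → (Fin m ⊕ Fin m₄) → ℝ),
      (∀ (i : Fin n) (e : Fin m ⊕ Fin m₄),
        v' i e = 0 ∨ ∃ q : ℕ, v' i e = w 0 / 2 ^ q) ∧
      (∀ (i : Fin n) (e : Fin m),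
        (0 < v i e → v i e / 2 < v' i (Sum.inl e) ∧ v' i (Sum.inl e) ≤ v i e) ∧
        (v i e = 0 → v' i (Sum.inl e) = 0)) ∧
      (∀ i : Fin n, ∑ e, v' i e = 1) ∧
      (∀ i : Fin n, WMMS w (v' i) i = WMMS w (v i) i ∧ WMMS w (v' i) i = w i) := by
  classical
  obtain ⟨hw, hv⟩ := hI
  have hex : ∀ i, ∃ f : Fin m → Fin n, ∀ j, cost (v i) f j = w j := fun i =>
    (WMMS_eq_weight_iff hw (by rw [hvsum, hwsum]) i).1 (hwmms i)
  choose f hf using hex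
  have hv0 : ∀ i e, v i e ≤ w 0 := fun i e => by
    refine le_trans ?_ (hmono 0 (f i e) (Fin.zero_le _))
    rw [← hf i]
    exact Finset.single_le_sum (f := v i) (fun x _ => hv i x) (by simp)
  choose r q hrq hrpos hrzero using fun i e => exists_round_down (hv i e) (hv0 i e)
  choose p hp using hpow
  have hr_le : ∀ i e, r i e ≤ v i e := fun i e => by
    rcases (hv i e).eq_or_lt with h | h
    · rw [hrzero i e h.symm, ← h]
    · exact (hrpos i e h).2
  have hr_nonneg : ∀ i e, 0 ≤ r i e := fun i e => by
    rcases hrq i e with h | h <;> rw [h]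
    exact div_nonneg (hw 0).le (by positivity)
  obtain ⟨Q, hqQ, hpQ⟩ : ∃ Q, (∀ i e, q i e ≤ Q) ∧ ∀ j, p j ≤ Q := by
    refine ⟨(univ.sup fun i => univ.sup (q i)) ⊔ univ.sup p, fun i e => ?_, fun j => ?_⟩
    · exact ((Finset.le_sup (f := q i) (mem_univ e)).trans
        (Finset.le_sup (f := fun i => univ.sup (q i)) (mem_univ i))).trans le_sup_left
    · exact (Finset.le_sup (mem_univ j)).trans le_sup_right
  set u : ℝ := w 0 / 2 ^ Q with hu
  have hu0 : 0 < u := div_pos (hw 0) (by positivity)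
  have hk : ∀ i j, ∃ k : ℕ, k ≤ 2 ^ Q ∧ cost (r i) (f i) j + k * u = w j := fun i j => by
    have hmem : w j - cost (r i) (f i) j ∈ AddSubgroup.zmultiples u := by
      refine sub_mem (hp j ▸ div_two_pow_mem_zmultiples _ (hpQ j)) (sum_mem fun e _ => ?_)
      rcases hrq i e with h | h <;> rw [h]
      · exact zero_mem _
      · exact div_two_pow_mem_zmultiples _ (hqQ i e)
    obtain ⟨z, hz⟩ := AddSubgroup.mem_zmultiples_iff.1 hmem
    rw [zsmul_eq_mul] at hz
    have hle : cost (r i) (f i) j ≤ w j := by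
      rw [← hf i j]
      exact Finset.sum_le_sum fun e _ => hr_le i e
    have hnonneg : 0 ≤ cost (r i) (f i) j := Finset.sum_nonneg fun e _ => hr_nonneg i e
    have hz0 : 0 ≤ z := by
      have : (0 : ℝ) ≤ z := nonneg_of_mul_nonneg_left (by linarith) hu0
      exact_mod_cast this
    lift z to ℕ using hz0
    rw [Int.cast_natCast] at hz
    refine ⟨z, ?_, by linarith⟩
    have h2 : (2 : ℝ) ^ Q * u = w 0 := by rw [hu]; field_simp
    have h3 : (z : ℝ) ≤ 2 ^ Q := le_of_mul_le_mul_right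
      (by linarith [hmono 0 j (Fin.zero_le _)]) hu0
    exact_mod_cast h3
  choose k hkQ hk using hk
  let E := finProdFinEquiv (m := n) (n := 2 ^ Q)
  let v' : Fin n → (Fin m ⊕ Fin (n * 2 ^ Q)) → ℝ := fun i =>
    Sum.elim (r i) fun x => if ((E.symm x).2 : ℕ) < k i (E.symm x).1 then u else 0
  let f' : Fin n → (Fin m ⊕ Fin (n * 2 ^ Q)) → Fin n := fun i =>
    Sum.elim (f i) fun x => (E.symm x).1
  have hcost : ∀ i j, cost (v' i) (f' i) j = w j := fun i j => by
    rw [← hk i j]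
    unfold cost
    rw [Finset.sum_filter, Fintype.sum_sum_type, Finset.sum_filter]
    congr 1
    rw [← E.sum_comp, Fintype.sum_prod_type, Finset.sum_eq_single j]
    · simp only [v', f', Sum.elim_inr, Equiv.symm_apply_apply, if_true]
      rw [Fin.sum_univ_eq_sum_range (fun t => if t < k i j then u else 0), ← Finset.sum_filter,
        Finset.sum_const, nsmul_eq_mul]
      have : (Finset.range (2 ^ Q)).filter (· < k i j) = Finset.range (k i j) := by
        ext t
        have := hkQ i j
        simp only [Finset.mem_filter, Finset.mem_range]
        omega
      rw [this, Finset.card_range]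
    · intro b _ hb
      simp [f', hb]
    · simp
  have hsum : ∀ i, ∑ e, v' i e = 1 := fun i => by
    rw [← sum_cost (v' i) (f' i), ← hwsum]
    exact Finset.sum_congr rfl fun j _ => hcost i j
  have hW : ∀ i, WMMS w (v' i) i = w i := fun i =>
    (WMMS_eq_weight_iff hw (by rw [hsum, hwsum]) i).2 ⟨f' i, hcost i⟩
  refine ⟨n * 2 ^ Q, v', ?_, fun i e => ⟨hrpos i e, hrzero i e⟩, hsum,
    fun i => ⟨by rw [hW, hwmms], hW i⟩⟩
  rintro i (e | x)
  · exact (hrq i e).imp id fun h => ⟨_, h⟩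
  · simp only [v', Sum.elim_inr]
    split_ifs
    · exact Or.inr ⟨Q, rfl⟩
    · exact Or.inl rfl

end Chores
end

section
/- In a canonical chore instance with weight groups G_1,…,G_k, fix an agent a in group G_i with valuation v, and let d = max{h : v(e_h) > w_i} (with d = 0 if no item has cost exceeding w_i for a). Then for every t with d < t ≤ m, Σ_{h=d+1}^{t} v(e_h) ≤ Σ_{h=d+1}^{t} v*_i(e_h), where v*_i is the proxy cost function of group i. -/
open Finset

namespace Chores

/-- `cum gw gn i s = L_i + n_i + n_{i+1} + ⋯ + n_s`. -/
noncomputable def cum {k : ℕ} (gw : Fin k → ℝ) (gn : Fin k → ℕ) (i s : Fin k) : ℝ :=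
  Lr gw gn i + ∑ t ∈ Finset.Icc i s, (gn t : ℝ)

open scoped Classical in
/-- The proxy cost function `v*_i` of group `i`, evaluated at the (1-based) `h`-th item:
it equals `w_i` for `h ≤ L_i + n_i`, equals `w_s` (for `i < s ≤ k`) when
`L_i + n_i + ⋯ + n_{s-1} < h ≤ L_i + n_i + ⋯ + n_s`, and `0` for
`h > L_i + n_i + ⋯ + n_k`. -/
noncomputable def proxy {k : ℕ} (gw : Fin k → ℝ) (gn : Fin k → ℕ) (i : Fin k) (h : ℕ) : ℝ :=
  if hS : (univ.filter (fun s : Fin k => i ≤ s ∧ (h : ℝ) ≤ cum gw gn i s)).Nonempty then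
    gw ((univ.filter (fun s : Fin k => i ≤ s ∧ (h : ℝ) ≤ cum gw gn i s)).min' hS)
  else 0

section Proxy

variable {k : ℕ} {gw : Fin k → ℝ} {gn : Fin k → ℕ} {i : Fin k}

lemma le_proxy (hgw : StrictAnti gw) {r : Fin k} {h : ℕ} (hir : i ≤ r)
    (hr : (h : ℝ) ≤ cum gw gn i r) : gw r ≤ proxy gw gn i h := by
  unfold proxy
  split_ifs with hS
  · apply hgw.antitone
    apply Finset.min'_le
    simp [hir, hr]
  · exact absurd ⟨r, by simp [hir, hr]⟩ hS

lemma proxy_nonneg (hpos : ∀ r, 0 < gw r) (h : ℕ) : 0 ≤ proxy gw gn i h := by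
  unfold proxy
  split_ifs
  · exact (hpos _).le
  · exact le_rfl

lemma proxy_eq_zero_or (h : ℕ) : proxy gw gn i h = 0 ∨
    ∃ s, i ≤ s ∧ (h : ℝ) ≤ cum gw gn i s ∧ proxy gw gn i h = gw s := by
  classical
  unfold proxy
  split_ifs with hS
  · right
    have := Finset.min'_mem _ hS
    rw [Finset.mem_filter] at this
    exact ⟨_, this.2.1, this.2.2, rfl⟩
  · exact Or.inl rfl

lemma proxy_antitone (hgw : StrictAnti gw) (hpos : ∀ r, 0 < gw r) :
    Antitone (proxy gw gn i) := by
  intro h h' hh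
  rcases proxy_eq_zero_or (gw := gw) (gn := gn) (i := i) h' with h0 | ⟨s, his, hs, he⟩
  · rw [h0]; exact proxy_nonneg hpos h
  · rw [he]; exact le_proxy hgw his (le_trans (by exact_mod_cast hh) hs)

lemma cum_mono : Monotone (cum gw gn i) := by
  intro r s hrs
  unfold cum
  gcongr

lemma proxy_le (hgw : StrictAnti gw) (hpos : ∀ r, 0 < gw r) {r : Fin k} {h : ℕ}
    (hr : cum gw gn i r < h) : proxy gw gn i h ≤ gw r := by
  rcases proxy_eq_zero_or (gw := gw) (gn := gn) (i := i) h with h0 | ⟨s, -, hs, he⟩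
  · rw [h0]; exact (hpos r).le
  · rw [he]
    apply hgw.antitone
    by_contra! hsr
    have := cum_mono (gw := gw) (gn := gn) (i := i) hsr.le
    linarith

lemma proxy_le_first (hgw : StrictAnti gw) (hpos : ∀ r, 0 < gw r) (h : ℕ) :
    proxy gw gn i h ≤ gw i := by
  rcases proxy_eq_zero_or (gw := gw) (gn := gn) (i := i) h with h0 | ⟨s, hs, -, he⟩
  · rw [h0]; exact (hpos i).le
  · rw [he]; exact hgw.antitone hs

lemma cum_self : cum gw gn i i = Lr gw gn i + gn i := by
  simp [cum]

lemma cum_add_le {r s : Fin k} (hir : i ≤ r) (hrs : r < s) :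
    cum gw gn i r + gn s ≤ cum gw gn i s := by
  unfold cum
  have : ∑ t ∈ Icc i r, (gn t : ℝ) + gn s ≤ ∑ t ∈ Icc i s, (gn t : ℝ) := by
    have hs : s ∉ Icc i r := by simp [hrs]
    rw [add_comm, ← Finset.sum_insert (f := fun t => (gn t : ℝ)) hs]
    apply Finset.sum_le_sum_of_subset_of_nonneg
    · intro t ht
      simp only [Finset.mem_insert, Finset.mem_Icc] at ht ⊢
      rcases ht with rfl | ht
      · exact ⟨hir.trans hrs.le, le_rfl⟩
      · exact ⟨ht.1, ht.2.trans hrs.le⟩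
    · intros; positivity
  linarith

/-- The excess of the proxy costs of the items `d+1, …, t` over their minimum is at least
the total excess of the groups whose segment ends before `t`. -/
lemma proxy_sum_ge (hgw : StrictAnti gw) (hpos : ∀ r, 0 < gw r) {N d t : ℕ}
    (hN : Lr gw gn i = N) (hdN : d ≤ N) (hdt : d < t) {θ : ℝ} (hθ : θ = proxy gw gn i t) :
    θ * ((t : ℝ) - d) + (gw i - θ) * ((N : ℝ) - d)
      + ∑ r ∈ univ.filter (fun r => i ≤ r), (gn r : ℝ) * max (gw r - θ) 0
      ≤ ∑ h ∈ Icc (d + 1) t, proxy gw gn i h := by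
  classical
  have hcard : ∑ h ∈ Icc (d + 1) t, θ = θ * ((t : ℝ) - d) := by
    rw [Finset.sum_const, Nat.card_Icc, nsmul_eq_mul,
      show t + 1 - (d + 1) = t - d by omega, Nat.cast_sub hdt.le]
    ring
  suffices h : (gw i - θ) * ((N : ℝ) - d)
      + ∑ r ∈ univ.filter (fun r => i ≤ r), (gn r : ℝ) * max (gw r - θ) 0
      ≤ ∑ h ∈ Icc (d + 1) t, (proxy gw gn i h - θ) by
    rw [Finset.sum_sub_distrib, hcard] at h
    linarith
  have hge : ∀ h ∈ Icc (d + 1) t, 0 ≤ proxy gw gn i h - θ := by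
    intro h hh
    rw [hθ, sub_nonneg]
    exact proxy_antitone hgw hpos (Finset.mem_Icc.1 hh).2
  let C : Fin k → ℕ := fun r => N + ∑ s ∈ Icc i r, gn s
  have hC : ∀ r, cum gw gn i r = C r := by
    intro r; simp [cum, C, hN]
  have hmax : ∀ r, i ≤ r → (t : ℕ) ≤ C r → max (gw r - θ) 0 = 0 := by
    intro r hir hr
    apply max_eq_right
    rw [hθ, sub_nonpos]
    exact le_proxy hgw hir (by rw [hC]; exact_mod_cast hr)
  have hmax' : ∀ r, C r < t → max (gw r - θ) 0 = gw r - θ := by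
    intro r hr
    apply max_eq_left
    rw [hθ, sub_nonneg]
    exact proxy_le hgw hpos (by rw [hC]; exact_mod_cast hr)
  have hCi : C i = N + gn i := by simp [C]
  rcases le_or_gt t (C i) with hti | hti
  · have h0 : ∀ r ∈ univ.filter (fun r => i ≤ r), (gn r : ℝ) * max (gw r - θ) 0 = 0 := by
      intro r hr
      have hir := (Finset.mem_filter.1 hr).2
      rw [hmax r hir (hti.trans ?_), mul_zero]
      have := cum_mono (gw := gw) (gn := gn) (i := i) hir
      rw [hC, hC] at this
      exact_mod_cast this
    have hθi : gw i - θ = 0 := by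
      have h1 := le_proxy (gn := gn) hgw (le_refl i) (h := t) (by rw [hC]; exact_mod_cast hti)
      have h2 := proxy_le_first (gn := gn) (i := i) hgw hpos t
      linarith
    rw [Finset.sum_eq_zero h0, hθi]
    simpa using Finset.sum_nonneg hge
  · let R := univ.filter (fun r => i ≤ r ∧ C r < t)
    let I : Fin k → Finset ℕ := fun r => if r = i then Ioc d (C r) else Ioc (C r - gn r) (C r)
    have hgn : ∀ r, i ≤ r → N + gn r ≤ C r := by
      intro r hir
      have := Finset.single_le_sum (f := gn) (fun _ _ => Nat.zero_le _)
        (Finset.mem_Icc.2 ⟨hir, le_refl r⟩)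
      simp only [C]; omega
    have hadd : ∀ r s, i ≤ r → r < s → C r + gn s ≤ C s := by
      intro r s hir hrs
      have := cum_add_le (gw := gw) (gn := gn) hir hrs
      rw [hC, hC] at this
      exact_mod_cast this
    have hval : ∀ r ∈ R, ∀ h ∈ I r, h ∈ Icc (d + 1) t ∧ gw r ≤ proxy gw gn i h ∧ h ≤ C r ∧
        ∀ s, i ≤ s → s < r → C s < h := by
      intro r hr h hh
      obtain ⟨-, hir, hrt⟩ := Finset.mem_filter.1 hr
      have hle : h ≤ C r := by
        simp only [I] at hh
        split_ifs at hh <;> exact (Finset.mem_Ioc.1 hh).2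
      refine ⟨?_, le_proxy hgw hir (by rw [hC]; exact_mod_cast hle), hle, ?_⟩
      · have := hgn r hir
        simp only [I] at hh
        split_ifs at hh <;> simp only [Finset.mem_Ioc, Finset.mem_Icc] at hh ⊢ <;> omega
      · intro s his hsr
        have hne : r ≠ i := (his.trans_lt hsr).ne'
        have := hadd s r his hsr
        simp only [I, if_neg hne, Finset.mem_Ioc] at hh
        omega
    have hdisj : (R : Set (Fin k)).PairwiseDisjoint I := by
      intro r hr s hs hrs
      rw [Function.onFun, Finset.disjoint_left]
      intro h hhr hhs
      obtain ⟨-, -, h1, h2⟩ := hval r hr h hhr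
      obtain ⟨-, -, h3, h4⟩ := hval s hs h hhs
      have hir := (Finset.mem_filter.1 (Finset.mem_coe.1 hr)).2.1
      have his := (Finset.mem_filter.1 (Finset.mem_coe.1 hs)).2.1
      rcases lt_or_gt_of_ne hrs with hlt | hlt
      · have := h4 r hir hlt; omega
      · have := h2 s his hlt; omega
    have hiR : i ∈ R := by simp [R, hti]
    have hsum : ∑ r ∈ univ.filter (fun r => i ≤ r), (gn r : ℝ) * max (gw r - θ) 0
        = ∑ r ∈ R, (gn r : ℝ) * (gw r - θ) := by
      have hRsub : R ⊆ univ.filter (fun r => i ≤ r) := by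
        intro r hr
        simp only [R, Finset.mem_filter] at hr ⊢
        exact ⟨hr.1, hr.2.1⟩
      rw [← Finset.sum_subset hRsub]
      · refine Finset.sum_congr rfl fun r hr => ?_
        rw [hmax' r (Finset.mem_filter.1 hr).2.2]
      · intro r hr hrR
        have hir := (Finset.mem_filter.1 hr).2
        rw [hmax r hir, mul_zero]
        by_contra! hlt
        exact hrR (by simp [R, hir, hlt])
    have hI : ∀ r ∈ R, ((I r).card : ℝ) = gn r + if r = i then (N : ℝ) - d else 0 := by
      intro r hr
      have hg := hgn r (Finset.mem_filter.1 hr).2.1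
      simp only [I]
      split_ifs with h
      · subst h
        rw [Nat.card_Ioc, Nat.cast_sub (by omega), hCi]
        push_cast; ring
      · rw [Nat.card_Ioc, show C r - (C r - gn r) = gn r by omega, add_zero]
    calc (gw i - θ) * ((N : ℝ) - d)
          + ∑ r ∈ univ.filter (fun r => i ≤ r), (gn r : ℝ) * max (gw r - θ) 0
        = ∑ r ∈ R, ((gn r : ℝ) + if r = i then (N : ℝ) - d else 0) * (gw r - θ) := by
          simp only [add_mul, Finset.sum_add_distrib, ite_mul, zero_mul,
            Finset.sum_ite_eq', if_pos hiR, hsum]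
          ring
      _ = ∑ r ∈ R, ∑ h ∈ I r, (gw r - θ) := by
          refine Finset.sum_congr rfl fun r hr => ?_
          rw [Finset.sum_const, nsmul_eq_mul, hI r hr]
      _ ≤ ∑ r ∈ R, ∑ h ∈ I r, (proxy gw gn i h - θ) := by
          refine Finset.sum_le_sum fun r hr => Finset.sum_le_sum fun h hh => ?_
          linarith [(hval r hr h hh).2.1]
      _ = ∑ h ∈ R.biUnion I, (proxy gw gn i h - θ) := (Finset.sum_biUnion hdisj).symm
      _ ≤ ∑ h ∈ Icc (d + 1) t, (proxy gw gn i h - θ) := by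
          apply Finset.sum_le_sum_of_subset_of_nonneg
          · intro h hh
            obtain ⟨r, hr, hh⟩ := Finset.mem_biUnion.1 hh
            exact (hval r hr h hh).1
          · exact fun h hh _ => hge h hh

end Proxy

lemma exists_cost_le {ι : Type*} [Fintype ι] {n : ℕ} [NeZero n] {w : Fin n → ℝ} {v : ι → ℝ}
    (hw : ∀ j, 0 < w j) {a : Fin n} (h : WMMS w v a = w a) :
    ∃ f : ι → Fin n, ∀ j, cost v f j ≤ w j := by
  classical
  obtain ⟨f, hf⟩ := exists_eq_ciInf_of_finite
    (f := fun f : ι → Fin n => ⨆ j : Fin n, cost v f j / w j)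
  refine ⟨f, fun j => ?_⟩
  have h1 : (⨆ j : Fin n, cost v f j / w j) = 1 := by
    rw [WMMS, ← hf] at h
    exact mul_left_cancel₀ (hw a).ne' (by rw [h, mul_one])
  have h2 := le_ciSup (f := fun j => cost v f j / w j) (Set.finite_range _).bddAbove j
  rw [h1] at h2
  exact (div_le_one (hw j)).1 h2

lemma sum_comp_weight {n k : ℕ} {w : Fin n → ℝ} {gw : Fin k → ℝ} {gn : Fin k → ℕ}
    (hg : Grouping w gw gn) (F : ℝ → ℝ) :
    ∑ j, F (w j) = ∑ r, (gn r : ℝ) * F (gw r) := by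
  classical
  obtain ⟨hanti, hex, hcard, -⟩ := hg
  have hinj : Function.Injective gw := StrictAnti.injective (fun r s h => hanti r s h)
  choose g hgr using hex
  rw [← Finset.sum_fiberwise (s := univ) (g := g)]
  refine Finset.sum_congr rfl fun r _ => ?_
  have hfil : univ.filter (fun j => g j = r) = univ.filter (fun j => w j = gw r) := by
    ext j
    simp only [Finset.mem_filter, Finset.mem_univ, true_and, hgr j]
    exact ⟨fun h => by rw [h], fun h => hinj h⟩
  have hc : (univ.filter (fun j => w j = gw r)).card = gn r := by
    rw [← hcard r]
  rw [hfil, ← hc, ← nsmul_eq_mul, ← Finset.sum_const]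
  refine Finset.sum_congr rfl fun j hj => ?_
  rw [(Finset.mem_filter.1 hj).2]

lemma exists_agent {n k : ℕ} {w : Fin n → ℝ} {gw : Fin k → ℝ} {gn : Fin k → ℕ}
    (hg : Grouping w gw gn) (r : Fin k) : ∃ j, w j = gw r := by
  classical
  obtain ⟨-, -, hcard, hpos⟩ := hg
  have h := hpos r
  rw [← hcard r, Finset.card_pos] at h
  obtain ⟨j, hj⟩ := h
  exact ⟨j, (Finset.mem_filter.1 hj).2⟩

lemma Lr_eq_natCast {n k : ℕ} [NeZero n] {w : Fin n → ℝ} {gw : Fin k → ℝ} {gn : Fin k → ℕ}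
    (hg : Grouping w gw gn) (hw : ∀ j, 0 < w j) (hpow : ∀ j, ∃ p : ℕ, w j = w 0 / 2 ^ p)
    (i : Fin k) : ∃ N : ℕ, Lr gw gn i = N := by
  have hq : ∀ r : Fin k, ∃ q : ℕ, r < i → gw r / gw i = q := by
    intro r
    by_cases hr : r < i
    · obtain ⟨j, hj⟩ := exists_agent hg r
      obtain ⟨l, hl⟩ := exists_agent hg i
      obtain ⟨p, hp⟩ := hpow j
      obtain ⟨q, hq⟩ := hpow l
      have h0 := hw 0
      have hlt := hg.1 r i hr
      rw [← hj, ← hl, hp, hq, div_lt_div_iff_of_pos_left h0 (by positivity) (by positivity)]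
        at hlt
      have hpq : p < q := (pow_lt_pow_iff_right₀ (by norm_num)).1 hlt
      obtain ⟨c, rfl⟩ := Nat.exists_eq_add_of_lt hpq
      refine ⟨2 ^ (c + 1), fun _ => ?_⟩
      rw [← hj, ← hl, hp, hq]
      push_cast
      field_simp
      ring
    · exact ⟨0, fun h => absurd h hr⟩
  choose q hq using hq
  refine ⟨∑ j ∈ univ.filter (fun j => j < i), gn j * q j, ?_⟩
  rw [Lr, Finset.sum_div]
  push_cast
  refine Finset.sum_congr rfl fun j hj => ?_
  rw [mul_div_assoc, hq j (Finset.mem_filter.1 hj).2]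

/-- The part `S` of a set of items of total cost at most `c`, each of cost at most `u`,
bounded through its cardinality. -/
lemma sum_le_card_mul_add {ι : Type*} {v : ι → ℝ} {S B : Finset ι} {c u θ : ℝ}
    (hu : 0 < u) (hθ : 0 ≤ θ) (hθu : θ ≤ u) (hSu : ∀ e ∈ S, v e ≤ u)
    (hB : ∀ e ∈ B, u < v e) (hv : ∀ e, 0 ≤ v e)
    (hS : ∑ e ∈ S, v e + ∑ e ∈ B, v e ≤ c) :
    ∑ e ∈ S, v e ≤ θ * S.card + (if u < c then (1 - θ / u) * c else max (c - θ) 0)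
      - (1 - θ / u) * ∑ e ∈ B, v e := by
  have hS0 : 0 ≤ ∑ e ∈ S, v e := Finset.sum_nonneg fun e _ => hv e
  have hθ1 : 0 ≤ 1 - θ / u := by rw [sub_nonneg, div_le_one hu]; exact hθu
  split_ifs with hcu
  · have h1 : ∑ e ∈ S, v e ≤ S.card * u := by
      simpa using Finset.sum_le_card_nsmul S v u hSu
    have h2 : (1 - θ / u) * ∑ e ∈ S, v e ≤ (1 - θ / u) * (c - ∑ e ∈ B, v e) :=
      mul_le_mul_of_nonneg_left (by linarith) hθ1
    have h3 : θ / u * ∑ e ∈ S, v e ≤ θ / u * (S.card * u) :=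
      mul_le_mul_of_nonneg_left h1 (by positivity)
    have h4 : θ / u * (S.card * u) = θ * S.card := by field_simp
    nlinarith
  · have hBe : B = ∅ := by
      by_contra hne
      obtain ⟨e, he⟩ := Finset.nonempty_iff_ne_empty.2 hne
      have := Finset.single_le_sum (fun e _ => hv e) he
      linarith [hB e he]
    subst hBe
    simp only [Finset.sum_empty, add_zero, mul_zero, sub_zero] at hS ⊢
    rcases le_or_gt c θ with hcθ | hcθ
    · have h1 : ∑ e ∈ S, v e ≤ S.card * θ := by
        have : ∀ e ∈ S, v e ≤ θ := fun e he =>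
          (Finset.single_le_sum (fun e _ => hv e) he).trans (hS.trans hcθ)
        simpa using Finset.sum_le_card_nsmul S v θ this
      linarith [le_max_right (c - θ) 0]
    · rcases S.eq_empty_or_nonempty with rfl | hne
      · simp
      · have h1 : (1 : ℝ) ≤ S.card := by exact_mod_cast hne.card_pos
        nlinarith [le_max_left (c - θ) 0]

/-- In a canonical chore instance with weight groups `G_1,…,G_k`,
fix an agent `a` in group `G_i` (i.e. `w a = gw i`), and let `d` be the largest
(1-based) index of an item whose cost to `a` exceeds `w_i` (with `d = 0` if there
is none); equivalently, since costs are nonincreasing, `v a (e_h) > w_i ↔ h ≤ d`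
for the 1-based index `h`. Then for every `t` with `d < t ≤ m`,
`Σ_{h=d+1}^{t} v a (e_h) ≤ Σ_{h=d+1}^{t} v*_i(e_h)`, where `v*_i` is the proxy
cost function of group `i`. -/
theorem proxy_dominates {n m k : ℕ} [NeZero n]
    (w : Fin n → ℝ) (v : Fin n → Fin m → ℝ) (gw : Fin k → ℝ) (gn : Fin k → ℕ)
    (hcan : Canonical w v) (hg : Grouping w gw gn)
    (i : Fin k) (a : Fin n) (ha : w a = gw i)
    (d : ℕ) (hdm : d ≤ m)
    (hd : ∀ h : Fin m, gw i < v a h ↔ (h : ℕ) + 1 ≤ d)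
    (t : ℕ) (hdt : d < t) (htm : t ≤ m) :
    ∑ h ∈ univ.filter (fun h : Fin m => d ≤ (h : ℕ) ∧ (h : ℕ) + 1 ≤ t), v a h
      ≤ ∑ h ∈ Finset.Icc (d + 1) t, proxy gw gn i h := by
  classical
  obtain ⟨⟨hw, hv⟩, -, -, hpow, -, -, -, hW⟩ := hcan
  have hgw : StrictAnti gw := fun r s h => hg.1 r s h
  have hpos : ∀ r, 0 < gw r := by
    intro r
    obtain ⟨j, hj⟩ := exists_agent hg r
    exact hj ▸ hw j
  have hu := hpos i
  obtain ⟨N, hN⟩ := Lr_eq_natCast hg hw hpow i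
  obtain ⟨f, hf⟩ := exists_cost_le hw (hW a)
  set S := univ.filter (fun h : Fin m => d ≤ (h : ℕ) ∧ (h : ℕ) + 1 ≤ t) with hSdef
  set B := univ.filter (fun h : Fin m => (h : ℕ) + 1 ≤ d) with hBdef
  have hScard : (S.card : ℝ) = (t : ℝ) - d := by
    have : S.card = (Ico d t).card := by
      rw [← Finset.card_map Fin.valEmbedding]
      congr 1
      ext x
      simp only [hSdef, Finset.mem_map, Finset.mem_filter, Finset.mem_univ, true_and,
        Fin.valEmbedding_apply, Finset.mem_Ico]
      exact ⟨by rintro ⟨y, hy, rfl⟩; omega, fun hx => ⟨⟨x, by omega⟩, by simp; omega, rfl⟩⟩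
    rw [this, Nat.card_Ico, Nat.cast_sub hdt.le]
  have hBcard : B.card = d := by
    have : B.card = (range d).card := by
      rw [← Finset.card_map Fin.valEmbedding]
      congr 1
      ext x
      simp only [hBdef, Finset.mem_map, Finset.mem_filter, Finset.mem_univ, true_and,
        Fin.valEmbedding_apply, Finset.mem_range]
      exact ⟨by rintro ⟨y, hy, rfl⟩; omega, fun hx => ⟨⟨x, by omega⟩, by simp; omega, rfl⟩⟩
    rw [this, Finset.card_range]
  have hSv : ∀ e ∈ S, v a e ≤ gw i := by
    intro e he
    by_contra! h
    have := (hd e).1 h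
    have := (Finset.mem_filter.1 he).2
    omega
  have hBv : ∀ e ∈ B, gw i < v a e := fun e he => (hd e).2 (Finset.mem_filter.1 he).2
  have hBsum : (d : ℝ) * gw i ≤ ∑ e ∈ B, v a e := by
    have := Finset.card_nsmul_le_sum B (v a) (gw i) fun e he => (hBv e he).le
    rwa [hBcard, nsmul_eq_mul] at this
  have hdisj : Disjoint S B := by
    rw [Finset.disjoint_left]
    intro e he he'
    have := (Finset.mem_filter.1 he).2
    have := (Finset.mem_filter.1 he').2
    omega
  have hbundle : ∀ j, ∑ e ∈ S.filter (fun e => f e = j), v a e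
      + ∑ e ∈ B.filter (fun e => f e = j), v a e ≤ w j := by
    intro j
    rw [← Finset.sum_union (Finset.disjoint_filter_filter hdisj)]
    refine le_trans ?_ (hf j)
    unfold cost
    apply Finset.sum_le_sum_of_subset_of_nonneg
    · intro e he
      simp only [Finset.mem_union, Finset.mem_filter, Finset.mem_univ, true_and] at he ⊢
      tauto
    · exact fun e _ _ => hv a e
  have hbound : ∀ θ : ℝ, 0 ≤ θ → θ ≤ gw i → ∑ e ∈ S, v a e ≤ θ * ((t : ℝ) - d)
      + ((gw i - θ) * N + ∑ r ∈ univ.filter (fun r => i ≤ r), (gn r : ℝ) * max (gw r - θ) 0)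
      - (1 - θ / gw i) * ∑ e ∈ B, v a e := by
    intro θ hθ hθu
    have hF : ∑ j, (if gw i < w j then (1 - θ / gw i) * w j else max (w j - θ) 0)
        = (gw i - θ) * N
          + ∑ r ∈ univ.filter (fun r => i ≤ r), (gn r : ℝ) * max (gw r - θ) 0 := by
      rw [sum_comp_weight hg (fun x => if gw i < x then (1 - θ / gw i) * x else max (x - θ) 0),
        ← hN, Lr, ← Finset.sum_filter_add_sum_filter_not univ (fun r => r < i)]
      congr 1
      · rw [Finset.sum_div, Finset.mul_sum]
        refine Finset.sum_congr rfl fun r hr => ?_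
        rw [if_pos (hgw (Finset.mem_filter.1 hr).2)]
        field_simp
      · simp only [not_lt]
        refine Finset.sum_congr rfl fun r hr => ?_
        rw [if_neg (not_lt.2 (hgw.antitone (Finset.mem_filter.1 hr).2))]
    have hsum := Finset.sum_le_sum fun j (_ : j ∈ (univ : Finset (Fin n))) =>
      sum_le_card_mul_add (S := S.filter (fun e => f e = j)) (B := B.filter (fun e => f e = j))
        hu hθ hθu (fun e he => hSv e (Finset.mem_filter.1 he).1)
        (fun e he => hBv e (Finset.mem_filter.1 he).1) (hv a) (hbundle j)
    have hcard : ∑ j, ((S.filter (fun e => f e = j)).card : ℝ) = S.card := by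
      have := Finset.card_eq_sum_card_fiberwise (f := f) (s := S) (t := univ)
        (fun _ _ => by simp)
      rw [this]
      push_cast
      rfl
    rwa [Finset.sum_sub_distrib, Finset.sum_add_distrib, ← Finset.mul_sum, ← Finset.mul_sum,
      Finset.sum_fiberwise, Finset.sum_fiberwise, hcard, hScard, hF] at hsum
  have hdN : d ≤ N := by
    have h1 : ∀ j, ∑ e ∈ B.filter (fun e => f e = j), v a e
        ≤ if gw i < w j then w j else 0 := by
      intro j
      have hS0 : 0 ≤ ∑ e ∈ S.filter (fun e => f e = j), v a e :=
        Finset.sum_nonneg fun e _ => hv a e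
      have hb := hbundle j
      split_ifs with hj
      · linarith
      · refine (Finset.sum_eq_zero fun e he => ?_).le
        have := Finset.single_le_sum (fun e _ => hv a e) he
        linarith [hBv e (Finset.mem_filter.1 he).1]
    have h2 := Finset.sum_le_sum fun j (_ : j ∈ (univ : Finset (Fin n))) => h1 j
    rw [Finset.sum_fiberwise, sum_comp_weight hg (fun x => if gw i < x then x else 0)] at h2
    have h3 : ∑ r, (gn r : ℝ) * (if gw i < gw r then gw r else 0) = N * gw i := by
      rw [← hN, Lr, div_mul_cancel₀ _ hu.ne', Finset.sum_filter]
      refine Finset.sum_congr rfl fun r _ => ?_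
      simp only [hgw.lt_iff_gt, mul_ite, mul_zero]
    have h4 : (d : ℝ) * gw i ≤ N * gw i := by linarith
    exact_mod_cast le_of_mul_le_mul_right h4 hu
  have hθ0 : 0 ≤ proxy gw gn i t := proxy_nonneg hpos t
  have hθi : proxy gw gn i t ≤ gw i := proxy_le_first hgw hpos t
  have h1 := hbound _ hθ0 hθi
  have h2 := proxy_sum_ge hgw hpos hN hdN hdt rfl
  have h3 : (1 - proxy gw gn i t / gw i) * (d * gw i)
      ≤ (1 - proxy gw gn i t / gw i) * ∑ e ∈ B, v a e :=
    mul_le_mul_of_nonneg_left hBsum (by rw [sub_nonneg, div_le_one hu]; exact hθi)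
  have h4 : (1 - proxy gw gn i t / gw i) * (d * gw i) = (gw i - proxy gw gn i t) * d := by
    field_simp
  linarith

end Chores
end

section
/- In a canonical chore instance with weight groups G_1,…,G_k, for any group indices 1 ≤ r₁ < r₂ ≤ k, Σ_{h=1}^{L_{r₂}} max(v*_{r₁}(e_h), w_{r₂}) ≤ 3·(W_1 + W_2 + … + W_{r₂−1}), where v*_{r₁} is the proxy cost function of group r₁ and the sum ranges over item indices h = 1,…,L_{r₂}. -/
open Finset

namespace Chores

theorem Grouping.gw_pos {n k : ℕ} {w : Fin n → ℝ} {gw : Fin k → ℝ} {gn : Fin k → ℕ}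
    (hg : Grouping w gw gn) (hw : ∀ i, 0 < w i) (r : Fin k) : 0 < gw r := by
  have h := hg.2.2.2 r
  rw [← hg.2.2.1 r, Finset.card_pos] at h
  obtain ⟨i, hi⟩ := h
  rw [← (Finset.mem_filter.1 hi).2]
  exact hw i

/-- Item `h` lies in the block on which the proxy of group `i` takes the value `gw s`. -/
def InBlock {k : ℕ} (gw : Fin k → ℝ) (gn : Fin k → ℕ) (i s : Fin k) (h : ℕ) : Prop :=
  (h : ℝ) ≤ cum gw gn i s ∧ ∀ t, i ≤ t → t < s → cum gw gn i t < h

open scoped Classical in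
theorem proxy_cases {k : ℕ} (gw : Fin k → ℝ) (gn : Fin k → ℕ) (i : Fin k) (h : ℕ) :
    proxy gw gn i h = 0 ∨ ∃ s, i ≤ s ∧ InBlock gw gn i s h ∧ proxy gw gn i h = gw s := by
  unfold proxy
  split_ifs with hS
  · right
    have hm := Finset.min'_mem _ hS
    have hlt := fun t => Finset.min'_le
      (univ.filter (fun s : Fin k => i ≤ s ∧ (h : ℝ) ≤ cum gw gn i s)) t
    refine ⟨_, (Finset.mem_filter.1 hm).2.1, ⟨(Finset.mem_filter.1 hm).2.2, ?_⟩, rfl⟩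
    intro t hit hts
    by_contra! hc
    exact absurd (hlt t (by simp [hit, hc])) (not_le.2 hts)
  · exact Or.inl rfl

open scoped Classical in
theorem card_inBlock_le {k : ℕ} (gw : Fin k → ℝ) (gn : Fin k → ℕ) (hgw : ∀ r, 0 < gw r)
    {i s : Fin k} (his : i ≤ s) (N : ℕ) :
    (((Finset.Icc 1 N).filter (InBlock gw gn i s)).card : ℝ)
      ≤ gn s + if s = i then Lr gw gn i else 0 := by
  have hL : 0 ≤ Lr gw gn i :=
    div_nonneg (Finset.sum_nonneg fun j _ => mul_nonneg (Nat.cast_nonneg _) (hgw j).le)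
      (hgw i).le
  have hcum : ∀ t, 0 ≤ cum gw gn i t := fun t =>
    add_nonneg hL (Finset.sum_nonneg fun _ _ => Nat.cast_nonneg _)
  rcases his.eq_or_lt with rfl | hlt
  · have hsub : (Finset.Icc 1 N).filter (InBlock gw gn i i) ⊆
        Finset.Icc 1 ⌊cum gw gn i i⌋₊ := by
      intro h hh
      obtain ⟨h1, h2⟩ := Finset.mem_filter.1 hh
      exact Finset.mem_Icc.2 ⟨(Finset.mem_Icc.1 h1).1, Nat.le_floor h2.1⟩
    have hc : (((Finset.Icc 1 N).filter (InBlock gw gn i i)).card : ℝ) ≤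
        (⌊cum gw gn i i⌋₊ : ℝ) := by
      exact_mod_cast (Finset.card_le_card hsub).trans_eq (by simp)
    have hf := Nat.floor_le (hcum i)
    have he : cum gw gn i i = Lr gw gn i + gn i := by simp [cum]
    rw [if_pos rfl]
    linarith
  · obtain ⟨t, ht⟩ : ∃ t : Fin k, t.val + 1 = s.val :=
      ⟨⟨s.val - 1, by omega⟩, by have : i.val < s.val := hlt; simp only; omega⟩
    have hlt' : i.val < s.val := hlt
    have hIcc : Finset.Icc i s = insert s (Finset.Icc i t) := by
      ext x
      simp only [Finset.mem_Icc, Finset.mem_insert, Fin.le_def, Fin.ext_iff]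
      omega
    have he : cum gw gn i s = cum gw gn i t + gn s := by
      unfold cum
      rw [hIcc, Finset.sum_insert (by simp only [Finset.mem_Icc, Fin.le_def]; omega)]
      ring
    have hsub : (Finset.Icc 1 N).filter (InBlock gw gn i s) ⊆
        Finset.Ioc ⌊cum gw gn i t⌋₊ ⌊cum gw gn i s⌋₊ := by
      intro h hh
      obtain ⟨-, h2⟩ := Finset.mem_filter.1 hh
      refine Finset.mem_Ioc.2 ⟨(Nat.floor_lt (hcum t)).2 (h2.2 t ?_ ?_), Nat.le_floor h2.1⟩
      · rw [Fin.le_def]; omega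
      · rw [Fin.lt_def]; omega
    have hc := Finset.card_le_card hsub
    rw [he, Nat.floor_add_natCast (hcum t), Nat.card_Ioc, Nat.add_sub_cancel_left] at hc
    rw [if_neg hlt.ne', add_zero]
    exact_mod_cast hc

/-- In a canonical chore instance with weight groups `G_1,…,G_k`,
for any group indices `r₁ < r₂`,
`Σ_{h=1}^{L_{r₂}} max (v*_{r₁}(e_h)) (w_{r₂}) ≤ 3·(W_1 + ⋯ + W_{r₂−1})`,
where `v*_{r₁}` is the proxy cost function of group `r₁`, the sum ranges over the
1-based item indices `h = 1,…,L_{r₂}`, and `L_{r₂}` is a (positive) integer. -/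
theorem proxy_truncated_sum_bound {n m k : ℕ} [NeZero n]
    (w : Fin n → ℝ) (v : Fin n → Fin m → ℝ) (gw : Fin k → ℝ) (gn : Fin k → ℕ)
    (hcan : Canonical w v) (hg : Grouping w gw gn)
    (r₁ r₂ : Fin k) (hr : r₁ < r₂)
    (L₂ : ℕ) (hL : (L₂ : ℝ) = Lr gw gn r₂) :
    ∑ h ∈ Finset.Icc 1 L₂, max (proxy gw gn r₁ h) (gw r₂)
      ≤ 3 * ∑ j ∈ univ.filter (fun j => j < r₂), (gn j : ℝ) * gw j := by
  classical
  have hgw : ∀ r, 0 < gw r := hg.gw_pos hcan.1.1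
  set S := ∑ j ∈ univ.filter (fun j => j < r₂), (gn j : ℝ) * gw j with hS
  have hS0 : 0 ≤ S := Finset.sum_nonneg fun j _ => mul_nonneg (Nat.cast_nonneg _) (hgw j).le
  have hpoint : ∀ h ∈ Finset.Icc 1 L₂, max (proxy gw gn r₁ h) (gw r₂) ≤
      gw r₂ + ∑ s ∈ Finset.Ico r₁ r₂, if InBlock gw gn r₁ s h then gw s else 0 := by
    intro h _
    have hnn : ∀ s ∈ Finset.Ico r₁ r₂, 0 ≤ if InBlock gw gn r₁ s h then gw s else 0 := by
      intro s _
      split_ifs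
      exacts [(hgw s).le, le_rfl]
    have hsum := Finset.sum_nonneg hnn
    refine max_le ?_ (by linarith)
    rcases proxy_cases gw gn r₁ h with h0 | ⟨s, his, hb, hp⟩
    · linarith [hgw r₂]
    · rcases lt_or_ge s r₂ with hs | hs
      · have hle := Finset.single_le_sum hnn (Finset.mem_Ico.2 ⟨his, hs⟩)
        rw [if_pos hb] at hle
        linarith [hgw r₂]
      · have hle : gw s ≤ gw r₂ := by
          rcases hs.eq_or_lt with rfl | hs
          exacts [le_rfl, (hg.1 _ _ hs).le]
        linarith
  have hblock : ∀ s ∈ Finset.Ico r₁ r₂,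
      (∑ h ∈ Finset.Icc 1 L₂, if InBlock gw gn r₁ s h then gw s else 0) ≤
        gn s * gw s + if s = r₁ then Lr gw gn r₁ * gw r₁ else 0 := by
    intro s hs
    rw [← Finset.sum_filter, Finset.sum_const, nsmul_eq_mul]
    refine (mul_le_mul_of_nonneg_right
      (card_inBlock_le gw gn hgw (Finset.mem_Ico.1 hs).1 L₂) (hgw s).le).trans_eq ?_
    split_ifs with h
    · subst h; ring
    · ring
  have hsplit : univ.filter (fun j => j < r₂) =
      univ.filter (fun j => j < r₁) ∪ Finset.Ico r₁ r₂ := by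
    ext x
    simp only [Finset.mem_filter, Finset.mem_univ, true_and, Finset.mem_union, Finset.mem_Ico,
      Fin.lt_def, Fin.le_def] at hr ⊢
    omega
  have hdisj : Disjoint (univ.filter (fun j => j < r₁)) (Finset.Ico r₁ r₂) := by
    refine Finset.disjoint_left.2 fun x hx hx' => ?_
    exact absurd (Finset.mem_filter.1 hx).2 (not_lt.2 (Finset.mem_Ico.1 hx').1)
  have hblocks : (∑ s ∈ Finset.Ico r₁ r₂,
      (gn s * gw s + if s = r₁ then Lr gw gn r₁ * gw r₁ else 0)) = S := by
    rw [Finset.sum_add_distrib, Finset.sum_ite_eq', if_pos (Finset.mem_Ico.2 ⟨le_rfl, hr⟩), hS,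
      hsplit, Finset.sum_union hdisj, Lr, div_mul_cancel₀ _ (hgw r₁).ne', add_comm]
  have hL₂ : (L₂ : ℝ) * gw r₂ = S := by
    rw [hL, Lr, div_mul_cancel₀ _ (hgw r₂).ne']
  have htot := Finset.sum_le_sum hpoint
  rw [Finset.sum_add_distrib, Finset.sum_const, nsmul_eq_mul, Nat.card_Icc,
    Nat.add_sub_cancel, hL₂, Finset.sum_comm] at htot
  linarith [Finset.sum_le_sum hblock]

end Chores
end

section
/- In the lower-bound instance Ī (defined in the context, for any integer k ≥ 4), the weighted maximin share of every agent equals her weight: for every i ∈ [k] and every agent a in group G_i, WMMS of a equals w_i. -/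
open Finset

namespace Chores

/-- The weight of an agent of (0-based) group `r` in the lower-bound instance `Ī`:
`w_1 = 1` for the first group, and `w_i = 2^{i−2}/n_i` with `n_i = Δ^{i−1}`,
`Δ = 2^k`, for groups `i ≥ 2` (here `i = r + 1`). -/
noncomputable def lbWeight (k : ℕ) (r : Fin k) : ℝ :=
  if (r : ℕ) = 0 then 1 else 2 ^ ((r : ℕ) - 1) / ((2 : ℝ) ^ k) ^ (r : ℕ)

/-- The cost, to an agent of (0-based) group `j`, of an item of (0-based) group `i`
carrying tag `t` in the lower-bound instance `Ī` (tag `0` = the part `T_i` of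
`M_i^1`, tag `1` = the part `T_i'` of `M_i^1`, tag `2` = `M_i^2`; items of group
`1` carry no meaningful tag). It realizes: `v_1(e) = 1` on `M_1`; for `i > j`,
cost `w_i` on `M_i^1` and `w_i/2` on `M_i^2`; for `j ≥ 2`, cost `2·w_j` on `B_j`
(that is, on `M_1 ∪ ⋯ ∪ M_{j−1} ∪ T_j`), `0` on `T_j'`, and `w_j` on `M_j^2`. -/
noncomputable def lbVal (k : ℕ) (j i : Fin k) (t : Fin 3) : ℝ :=
  if (i : ℕ) < (j : ℕ) then 2 * lbWeight k j
  else if (i : ℕ) = (j : ℕ) then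
    if (j : ℕ) = 0 then 1
    else if (t : ℕ) = 0 then 2 * lbWeight k j
    else if (t : ℕ) = 1 then 0
    else lbWeight k j
  else if (t : ℕ) = 2 then lbWeight k i / 2 else lbWeight k i

/-- If the items split into classes of constant cost `V`, and the classes can be distributed
with multiplicities `m` so that every agent receives exactly her weight, then the weighted maximin
share of every agent is her weight. -/
theorem WMMS_eq_of_multiplicities {ι κ : Type*} [Fintype ι] [Fintype κ] [DecidableEq κ] {n : ℕ}
    (w : Fin n → ℝ) (hw : ∀ b, 0 < w b) (v : ι → ℝ) (cls : ι → κ) (V : κ → ℝ)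
    (hv : ∀ e, v e = V (cls e)) (m : κ → Fin n → ℕ)
    (hcard : ∀ c, (univ.filter (fun e => cls e = c)).card = ∑ b, m c b)
    (hm : ∀ b, ∑ c, (m c b : ℝ) * V c = w b) (a : Fin n) :
    WMMS w v a = w a := by
  have : Nonempty (Fin n) := ⟨a⟩
  have hsum (F : ι → Fin n) : ∑ b, cost v F b = ∑ e, v e := by
    simp only [cost]
    exact sum_fiberwise univ F v
  obtain ⟨f, hf⟩ : ∃ f : ι → Fin n, ∀ b, cost v f b = w b := by
    have hE (c : κ) : Nonempty ({e // cls e = c} ≃ Σ b, Fin (m c b)) := by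
      refine ⟨Fintype.equivOfCardEq ?_⟩
      rw [Fintype.card_subtype, hcard c]
      simp
    let E (c : κ) := (hE c).some
    let G : ι ≃ Σ c, Σ b, Fin (m c b) :=
      (Equiv.sigmaFiberEquiv cls).symm.trans (Equiv.sigmaCongrRight E)
    refine ⟨fun e => (G e).2.1, fun b => ?_⟩
    rw [cost, sum_filter, ← hm b]
    calc ∑ e, (if (G e).2.1 = b then v e else 0)
        = ∑ x : Σ c, Σ b, Fin (m c b), if x.2.1 = b then V x.1 else 0 :=
          Fintype.sum_equiv G _ _ fun e => by rw [hv e]; rfl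
      _ = ∑ c, (m c b : ℝ) * V c := by
          rw [Fintype.sum_sigma]
          refine sum_congr rfl fun c _ => ?_
          rw [Fintype.sum_sigma]
          calc ∑ b', ∑ _i : Fin (m c b'), (if b' = b then V c else 0)
              = ∑ b', if b' = b then (m c b' : ℝ) * V c else 0 :=
                sum_congr rfl fun b' _ => by
                  rw [sum_const, card_univ, Fintype.card_fin, nsmul_eq_mul, mul_ite, mul_zero]
            _ = (m c b : ℝ) * V c := by rw [sum_ite_eq', if_pos (mem_univ b)]
  have htotal : ∑ e, v e = ∑ b, w b := by
    rw [← hsum f]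
    exact sum_congr rfl fun b _ => hf b
  have hinf : ⨅ F : ι → Fin n, ⨆ b, cost v F b / w b = 1 := by
    have : Nonempty (ι → Fin n) := ⟨f⟩
    apply le_antisymm
    · refine (ciInf_le (Set.finite_range _).bddBelow f).trans (ciSup_le fun b => ?_)
      rw [hf b, div_self (hw b).ne']
    · refine le_ciInf fun F => ?_
      obtain ⟨b, -, hb⟩ := exists_le_of_sum_le (s := univ) (f := w) (g := cost v F)
        univ_nonempty (by rw [hsum F, htotal])
      exact ((one_le_div (hw b)).2 hb).trans
        (le_ciSup (f := fun b => cost v F b / w b) (Set.finite_range _).bddAbove b)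
  rw [WMMS, hinf, mul_one]

theorem lbWeight_pos (k : ℕ) (r : Fin k) : 0 < lbWeight k r := by
  unfold lbWeight
  split_ifs <;> positivity

theorem pow_mul_lbWeight (k : ℕ) (r : Fin k) :
    ((2 : ℝ) ^ k) ^ (r : ℕ) * lbWeight k r = if (r : ℕ) = 0 then 1 else 2 ^ ((r : ℕ) - 1) := by
  unfold lbWeight
  split_ifs with h
  · simp [h]
  · field_simp

/-- The groups below group `j` have the same total weight as group `j`. -/
theorem sum_group_weights_lt (k : ℕ) (j : Fin k) (hj : (j : ℕ) ≠ 0) :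
    ∑ q ∈ univ.filter (fun q => q < j), ((2 : ℝ) ^ k) ^ (q : ℕ) * lbWeight k q
      = ((2 : ℝ) ^ k) ^ (j : ℕ) * lbWeight k j := by
  have hgeom (n : ℕ) : ∑ q ∈ range (n + 1), (if q = 0 then (1 : ℝ) else 2 ^ (q - 1)) = 2 ^ n := by
    induction n with
    | zero => simp
    | succ n ih =>
      rw [sum_range_succ, ih]
      simp
      ring
  have hmap : (univ.filter (fun q => q < j)).map Fin.valEmbedding = range j := by
    ext x
    simp only [mem_map, mem_filter, mem_univ, true_and, Fin.valEmbedding_apply, mem_range]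
    exact ⟨fun ⟨q, hq, hx⟩ => hx ▸ hq, fun hx => ⟨⟨x, hx.trans j.2⟩, hx, rfl⟩⟩
  simp only [pow_mul_lbWeight]
  rw [if_neg hj, ← hgeom, Nat.sub_add_cancel (Nat.one_le_iff_ne_zero.2 hj), ← hmap, sum_map]
  rfl

/-- The weight of a group `q < j` is an even multiple of the weight of group `j`. -/
theorem exists_even_multiple_lbWeight (k : ℕ) (hk : 2 ≤ k) (j q : Fin k) (hq : q < j) :
    ∃ h : ℕ, (h : ℝ) * (2 * lbWeight k j) = lbWeight k q := by
  obtain ⟨q, hqk⟩ := q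
  obtain ⟨j, hjk⟩ := j
  simp only [Fin.mk_lt_mk] at hq
  obtain ⟨d, rfl⟩ := Nat.exists_eq_add_of_lt hq
  obtain ⟨l, rfl⟩ := Nat.exists_eq_add_of_le' hk
  rcases Nat.eq_zero_or_pos q with rfl | hq0
  · refine ⟨2 ^ ((l + 1) * (d + 1)), ?_⟩
    simp only [lbWeight, if_pos, Nat.zero_add, Nat.add_sub_cancel]
    rw [if_neg (Nat.succ_ne_zero d)]
    push_cast
    field_simp
    simp only [← pow_mul, ← pow_succ, ← pow_add]
    congr 1
    ring
  · obtain ⟨p, rfl⟩ : ∃ p, q = p + 1 := ⟨q - 1, by omega⟩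
    refine ⟨2 ^ ((l + 1) * d + l), ?_⟩
    simp only [lbWeight]
    rw [if_neg (by omega), if_neg (by omega)]
    push_cast
    field_simp
    simp only [← pow_mul, ← pow_succ, ← pow_add]
    congr 1
    ring

/-- The class of an item of group `i` with tag `t` from the point of view of group `j`. All items
of `B_j` form the class `(j, 0)`, and the only item of the first group has class `(j, 2)`
when `j` is the first group. -/
def itemClass {k : ℕ} (j i : Fin k) (t : Fin 3) : Fin k × Fin 3 :=
  if i < j then (j, 0)
  else if i = j then (j, if (j : ℕ) = 0 then 2 else t)
  else (i, if t = 2 then 2 else 0)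

theorem itemClass_fst_not_lt {k : ℕ} (j i : Fin k) (t : Fin 3) : ¬ (itemClass j i t).1 < j := by
  unfold itemClass
  rcases lt_trichotomy i j with h | rfl | h
  · simp [h]
  · simp
  · simp [h.not_gt, h.ne']

theorem itemClass_eq_self_zero_iff {k : ℕ} (j i : Fin k) (t : Fin 3) :
    itemClass j i t = (j, 0) ↔ i < j ∨ i = j ∧ (j : ℕ) ≠ 0 ∧ (t : ℕ) = 0 := by
  unfold itemClass
  rcases lt_trichotomy i j with h | rfl | h
  · simp [h]
  · by_cases h0 : (i : ℕ) = 0 <;> fin_cases t <;> simp [h0]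
  · simp [h.not_gt, h.ne']

theorem itemClass_eq_self_two_iff {k : ℕ} (j i : Fin k) (t : Fin 3) :
    itemClass j i t = (j, 2) ↔ i = j ∧ ((j : ℕ) ≠ 0 → (t : ℕ) = 2) := by
  unfold itemClass
  rcases lt_trichotomy i j with h | rfl | h
  · simp [h, h.ne]
  · by_cases h0 : (i : ℕ) = 0 <;> fin_cases t <;> simp [h0]
  · simp [h.not_gt, h.ne']

theorem itemClass_eq_iff_of_lt {k : ℕ} {j r : Fin k} (h : j < r) (i : Fin k) (t s : Fin 3) :
    itemClass j i t = (r, s) ↔ i = r ∧ (if (t : ℕ) = 2 then 2 else 0) = s := by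
  unfold itemClass
  rcases lt_trichotomy i j with hi | rfl | hi
  · simp [hi, h.ne, (hi.trans h).ne]
  · simp [h.ne]
  · fin_cases t <;> simp [hi.not_gt, hi.ne']

/-- The cost, to an agent of group `j`, of an item of the given class. -/
noncomputable def classCost {k : ℕ} (j : Fin k) (c : Fin k × Fin 3) : ℝ :=
  if c.1 = j then ![2 * lbWeight k j, 0, lbWeight k j] c.2
  else ![lbWeight k c.1, 0, lbWeight k c.1 / 2] c.2

theorem lbVal_eq_classCost {k : ℕ} (j i : Fin k) (t : Fin 3) :
    lbVal k j i t = classCost j (itemClass j i t) := by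
  unfold lbVal classCost itemClass
  rcases lt_trichotomy i j with h | rfl | h
  · simp [h]
  · by_cases h0 : (i : ℕ) = 0
    · simp [h0, lbWeight]
    · fin_cases t <;> simp [h0]
  · have h1 : ¬ (i : ℕ) < j := not_lt.2 h.le
    have h2 : (i : ℕ) ≠ j := fun h' => h.ne' (Fin.ext h')
    fin_cases t <;> simp [h.not_gt, h.ne', h1, h2]

/-- In the lower-bound instance `Ī` (for any integer `k ≥ 4`,
with `Δ = 2^k`), the weighted maximin share of every agent equals her weight:
for every agent `a` (lying in group `G_{gA a}`), her WMMS equals `w_{gA a}`. -/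
theorem lb_instance_WMMS_eq_weight
    (k : ℕ) (hk : 4 ≤ k) (nA nM : ℕ)
    (gA : Fin nA → Fin k) (gM : Fin nM → Fin k) (tag : Fin nM → Fin 3)
    -- group sizes: `n_i = Δ^{i−1}` agents in group `G_i`, `Δ = 2^k`
    (hA : ∀ r : Fin k,
      (univ.filter (fun a => gA a = r)).card = (2 ^ k) ^ (r : ℕ))
    -- item group sizes: `m_1 = 1` and `m_i = (3/2)·Δ^{i−1}` for `i ≥ 2`
    (hM0 : ∀ r : Fin k, (r : ℕ) = 0 →
      (univ.filter (fun e => gM e = r)).card = 1)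
    (hMr : ∀ r : Fin k, (r : ℕ) ≠ 0 →
      2 * (univ.filter (fun e => gM e = r)).card = 3 * (2 ^ k) ^ (r : ℕ))
    -- for `i ≥ 2`: `|M_i^1| = n_i/2` and `|M_i^2| = n_i`
    (hM1 : ∀ r : Fin k, (r : ℕ) ≠ 0 →
      2 * (univ.filter (fun e => gM e = r ∧ (tag e : ℕ) ≠ 2)).card = (2 ^ k) ^ (r : ℕ))
    (hM2 : ∀ r : Fin k, (r : ℕ) ≠ 0 →
      (univ.filter (fun e => gM e = r ∧ (tag e : ℕ) = 2)).card = (2 ^ k) ^ (r : ℕ))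
    -- for `i ≥ 2`: `|T_i| = m_i/3 − (m_1 + ⋯ + m_{i−1})`
    (hT : ∀ r : Fin k, (r : ℕ) ≠ 0 →
      2 * (univ.filter (fun e => gM e = r ∧ (tag e : ℕ) = 0)).card
        + 2 * ∑ q ∈ univ.filter (fun q => q < r),
            (univ.filter (fun e => gM e = q)).card
      = (2 ^ k) ^ (r : ℕ))
    (a : Fin nA) :
    WMMS (fun b => lbWeight k (gA b)) (fun e => lbVal k (gA a) (gM e) (tag e)) a
      = lbWeight k (gA a) := by
  obtain ⟨j, hj⟩ : ∃ j, gA a = j := ⟨_, rfl⟩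
  have hhalf (r : Fin k) : ∃ H : Finset (Fin nA), (r : ℕ) ≠ 0 →
      H ⊆ univ.filter (fun b => gA b = r) ∧ 2 * H.card = (2 ^ k) ^ (r : ℕ) := by
    by_cases hr : (r : ℕ) = 0
    · exact ⟨∅, fun h => absurd hr h⟩
    · obtain ⟨H, hH, hc⟩ := exists_subset_card_eq (s := univ.filter (fun b => gA b = r))
        (n := (univ.filter (fun e => gM e = r ∧ (tag e : ℕ) ≠ 2)).card)
        (by rw [hA r, ← hM1 r hr]; omega)
      exact ⟨H, fun _ => ⟨hH, by rw [hc, hM1 r hr]⟩⟩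
  choose H hH using hhalf
  have hmult (q : Fin k) : ∃ h : ℕ, q < j → (h : ℝ) * (2 * lbWeight k j) = lbWeight k q := by
    by_cases hq : q < j
    · obtain ⟨h, hh⟩ := exists_even_multiple_lbWeight k (by omega) j q hq
      exact ⟨h, fun _ => hh⟩
    · exact ⟨0, fun h => absurd h hq⟩
  choose h hh using hmult
  let cls (e : Fin nM) : Fin k × Fin 3 := itemClass j (gM e) (tag e)
  let m (c : Fin k × Fin 3) (b : Fin nA) : ℕ :=
    if c.1 < j then 0
    else if c.1 = j then
      ![if gA b < j then h (gA b) else 0,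
        if b = a then (univ.filter (fun e => cls e = (j, 1))).card else 0,
        if gA b = j then 1 else 0] c.2
    else
      ![if b ∈ H c.1 then 1 else 0, 0, if gA b = c.1 ∧ b ∉ H c.1 then 2 else 0] c.2
  refine WMMS_eq_of_multiplicities _ (fun b => lbWeight_pos k _) _ cls (classCost j)
    (fun e => by rw [hj]; exact lbVal_eq_classCost j _ _) m ?_ ?_ a
  · rintro ⟨i, t⟩
    rcases lt_trichotomy i j with hi | rfl | hi
    · simp only [m, hi, if_true, sum_const_zero, card_eq_zero, filter_eq_empty_iff]
      intro e _ he
      exact itemClass_fst_not_lt j (gM e) (tag e) ((congrArg Prod.fst he).trans_lt hi)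
    · obtain rfl | rfl | rfl : t = 0 ∨ t = 1 ∨ t = 2 := by fin_cases t <;> simp
      · have hR : ∑ b, m (i, 0) b = ∑ q ∈ univ.filter (fun q => q < i), (2 ^ k) ^ (q : ℕ) * h q := by
          rw [← sum_fiberwise univ gA, sum_filter]
          refine sum_congr rfl fun q _ => ?_
          rw [sum_congr rfl (g := fun _ => if q < i then h q else 0)
            fun b hb => by simp [m, (mem_filter.1 hb).2], sum_const, hA q]
          split_ifs <;> simp
        rw [hR]
        by_cases hi0 : (i : ℕ) = 0
        · have hlt (q : Fin k) : ¬ q < i := by simp [Fin.lt_def, hi0]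
          simp [cls, itemClass_eq_self_zero_iff, hlt, hi0]
        · have hL : univ.filter (fun e => cls e = (i, 0)) = univ.filter (fun e => gM e < i) ∪
              univ.filter (fun e => gM e = i ∧ (tag e : ℕ) = 0) := by
            ext e
            simp [cls, itemClass_eq_self_zero_iff, hi0]
          have hD : Disjoint (univ.filter (fun e => gM e < i))
              (univ.filter (fun e => gM e = i ∧ (tag e : ℕ) = 0)) :=
            disjoint_filter.2 fun e _ h1 h2 => h1.ne h2.1
          have hlow : (univ.filter (fun e => gM e < i)).card
              = ∑ q ∈ univ.filter (fun q => q < i), (univ.filter (fun e => gM e = q)).card := by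
            rw [card_eq_sum_card_fiberwise (f := gM) (t := univ.filter (fun q => q < i))
              (fun e he => by simpa using he)]
            refine sum_congr rfl fun q hq => ?_
            rw [filter_filter]
            congr 1
            ext e
            simp only [mem_filter, mem_univ, true_and] at hq ⊢
            exact and_iff_right_of_imp fun h' => h' ▸ hq
          have hsum := sum_group_weights_lt k i hi0
          rw [sum_congr rfl (g := fun q : Fin k =>
              (((2 ^ k) ^ (q : ℕ) * h q : ℕ) : ℝ) * (2 * lbWeight k i)) fun q hq => by
            rw [← hh q (mem_filter.1 hq).2]; push_cast; ring, ← sum_mul, ← Nat.cast_sum] at hsum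
          have hcount : 2 * ∑ q ∈ univ.filter (fun q => q < i), (2 ^ k) ^ (q : ℕ) * h q
              = (2 ^ k) ^ (i : ℕ) := by
            have := mul_right_cancel₀ (b := lbWeight k i) (lbWeight_pos k i).ne'
              ((by ring : _ = _).trans hsum :
                (2 * ((∑ q ∈ univ.filter (fun q => q < i), (2 ^ k) ^ (q : ℕ) * h q : ℕ) : ℝ))
                  * lbWeight k i = _)
            exact_mod_cast this
          have := hT i hi0
          rw [hL, card_union_of_disjoint hD, hlow]
          omega
      · simp [m]
      · have hR : ∑ b, m (i, 2) b = (2 ^ k) ^ (i : ℕ) := by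
          simp [m, ← hA i]
        rw [hR]
        by_cases hi0 : (i : ℕ) = 0
        · rw [hi0, pow_zero, ← hM0 i hi0]
          simp [cls, itemClass_eq_self_two_iff, hi0]
        · rw [← hM2 i hi0]
          simp [cls, itemClass_eq_self_two_iff, hi0]
    · have hi0 : (i : ℕ) ≠ 0 := by have : (j : ℕ) < i := hi; omega
      obtain ⟨hs, hc⟩ := hH i hi0
      obtain rfl | rfl | rfl : t = 0 ∨ t = 1 ∨ t = 2 := by fin_cases t <;> simp
      · have hR : ∑ b, m (i, 0) b = (H i).card := by
          simp [m, hi.not_gt, hi.ne']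
        have hL : univ.filter (fun e => cls e = (i, 0))
            = univ.filter (fun e => gM e = i ∧ (tag e : ℕ) ≠ 2) := by
          ext e
          by_cases ht : (tag e : ℕ) = 2 <;> simp [cls, itemClass_eq_iff_of_lt hi, ht]
        have := hM1 i hi0
        rw [hR, hL]
        omega
      · simp only [m, hi.not_gt, hi.ne', if_false, Matrix.cons_val, sum_const_zero, card_eq_zero,
          filter_eq_empty_iff, cls, itemClass_eq_iff_of_lt hi]
        rintro e - ⟨-, he⟩
        split_ifs at he <;> simp at he
      · have hR : ∑ b, m (i, 2) b = 2 * (univ.filter (fun b => gA b = i) \ H i).card := by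
          rw [card_eq_sum_ones, mul_sum, ← filter_notMem_eq_sdiff, filter_filter, sum_filter]
          simp [m, hi.not_gt, hi.ne']
        have hL : univ.filter (fun e => cls e = (i, 2))
            = univ.filter (fun e => gM e = i ∧ (tag e : ℕ) = 2) := by
          ext e
          by_cases ht : (tag e : ℕ) = 2 <;> simp [cls, itemClass_eq_iff_of_lt hi, ht]
        rw [hR, hL, hM2 i hi0, card_sdiff_of_subset hs, hA i]
        omega
  · intro b
    have hinner (i : Fin k) : ∑ t : Fin 3, (m (i, t) b : ℝ) * classCost j (i, t)
        = if max (gA b) j = i then lbWeight k (gA b) else 0 := by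
      rw [Fin.sum_univ_three]
      rcases lt_trichotomy i j with hi | rfl | hi
      · have : max (gA b) j ≠ i := (lt_max_of_lt_right hi).ne'
        simp [m, hi, this]
      · rcases lt_trichotomy (gA b) i with hb | hb | hb
        · simp [m, classCost, hb, hb.ne, hb.le, hh]
        · simp [m, classCost, hb]
        · simp [m, classCost, hb.not_gt, hb.ne', hb.le]
      · have hi0 : (i : ℕ) ≠ 0 := by have : (j : ℕ) < i := hi; omega
        have hs := (hH i hi0).1
        by_cases hb : gA b = i
        · by_cases hbH : b ∈ H i <;> simp [m, classCost, hi.not_gt, hi.ne', hb, hbH, hi.le]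
          ring
        · have hbH : b ∉ H i := fun h' => hb (mem_filter.1 (hs h')).2
          have : max (gA b) j ≠ i := by
            rcases max_choice (gA b) j with h' | h' <;> rw [h']
            exacts [hb, hi.ne]
          simp [m, classCost, hi.not_gt, hi.ne', hb, hbH, this]
    rw [Fintype.sum_prod_type]
    simp only [hinner, sum_ite_eq, mem_univ, if_true]

end Chores
end

section
/- In the lower-bound instance Ī (defined in the context, for any integer k ≥ 4), if an allocation gives every agent in every group G_i a bundle of cost strictly less than 2·w_i (i.e., the allocation is better than 2-WMMS, since each agent's WMMS equals her weight), then for each i ∈ [k−1] every item of B_{i+1} is allocated to an agent in G_1 ∪ … ∪ G_i. -/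
open Finset

namespace Chores

theorem lbVal_nonneg (k : ℕ) (j i : Fin k) (t : Fin 3) : 0 ≤ lbVal k j i t := by
  have hj := lbWeight_pos k j
  have hi := lbWeight_pos k i
  unfold lbVal
  split_ifs <;> positivity

/-- An item of `B_r` costs an agent of group `j ≥ r` exactly twice her weight. -/
theorem lbVal_eq_two_mul_lbWeight {k : ℕ} {r j i : Fin k} {t : Fin 3} (hr : (r : ℕ) ≠ 0)
    (hrj : (r : ℕ) ≤ j) (h : (i : ℕ) < r ∨ (i = r ∧ (t : ℕ) = 0)) :
    lbVal k j i t = 2 * lbWeight k j := by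
  unfold lbVal
  obtain h | ⟨rfl, ht⟩ := h
  · rw [if_pos (h.trans_le hrj)]
  · obtain hlt | heq := hrj.lt_or_eq
    · rw [if_pos hlt]
    · rw [if_neg heq.not_lt, if_pos heq, if_neg (heq ▸ hr), if_pos ht]

/-- With nonnegative costs, the cost of an item is at most that of the bundle containing it. -/
theorem le_cost {ι : Type*} [Fintype ι] {n : ℕ} {v : ι → ℝ} (hv : ∀ e, 0 ≤ v e)
    (f : ι → Fin n) (e : ι) : v e ≤ cost v f (f e) :=
  single_le_sum (f := v) (fun x _ => hv x) (by simp)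

/-- In the lower-bound instance `Ī` (for any integer `k ≥ 4`,
with `Δ = 2^k`), if an allocation `f` gives every agent of every group `G_i` a
bundle of cost strictly less than `2·w_i` (i.e. the allocation is better than
2-WMMS, as each agent's WMMS equals her weight), then for each `i ∈ [k−1]` every
item of `B_{i+1} = M_1 ∪ ⋯ ∪ M_i ∪ T_{i+1}` is allocated to an agent of
`G_1 ∪ ⋯ ∪ G_i`. -/
theorem lb_instance_B_items_to_lower_groups
    (k : ℕ) (hk : 4 ≤ k) (nA nM : ℕ)
    (gA : Fin nA → Fin k) (gM : Fin nM → Fin k) (tag : Fin nM → Fin 3)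
    -- group sizes: `n_i = Δ^{i−1}` agents in group `G_i`, `Δ = 2^k`
    (hA : ∀ r : Fin k,
      (univ.filter (fun a => gA a = r)).card = (2 ^ k) ^ (r : ℕ))
    -- item group sizes: `m_1 = 1` and `m_i = (3/2)·Δ^{i−1}` for `i ≥ 2`
    (hM0 : ∀ r : Fin k, (r : ℕ) = 0 →
      (univ.filter (fun e => gM e = r)).card = 1)
    (hMr : ∀ r : Fin k, (r : ℕ) ≠ 0 →
      2 * (univ.filter (fun e => gM e = r)).card = 3 * (2 ^ k) ^ (r : ℕ))
    -- for `i ≥ 2`: `|M_i^1| = n_i/2` and `|M_i^2| = n_i`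
    (hM1 : ∀ r : Fin k, (r : ℕ) ≠ 0 →
      2 * (univ.filter (fun e => gM e = r ∧ (tag e : ℕ) ≠ 2)).card = (2 ^ k) ^ (r : ℕ))
    (hM2 : ∀ r : Fin k, (r : ℕ) ≠ 0 →
      (univ.filter (fun e => gM e = r ∧ (tag e : ℕ) = 2)).card = (2 ^ k) ^ (r : ℕ))
    -- for `i ≥ 2`: `|T_i| = m_i/3 − (m_1 + ⋯ + m_{i−1})`
    (hT : ∀ r : Fin k, (r : ℕ) ≠ 0 →
      2 * (univ.filter (fun e => gM e = r ∧ (tag e : ℕ) = 0)).card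
        + 2 * ∑ q ∈ univ.filter (fun q => q < r),
            (univ.filter (fun e => gM e = q)).card
      = (2 ^ k) ^ (r : ℕ))
    (f : Fin nM → Fin nA)
    (hf : ∀ a : Fin nA,
      cost (fun e => lbVal k (gA a) (gM e) (tag e)) f a < 2 * lbWeight k (gA a)) :
    ∀ r : Fin k, (r : ℕ) ≠ 0 → ∀ e : Fin nM,
      ((gM e : ℕ) < (r : ℕ) ∨ (gM e = r ∧ (tag e : ℕ) = 0)) →
      (gA (f e) : ℕ) < (r : ℕ) := by
  intro r hr e he
  by_contra! hle
  have hcost := (le_cost (fun e' => lbVal_nonneg k (gA (f e)) (gM e') (tag e')) f e).trans_lt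
    (hf (f e))
  exact hcost.ne (lbVal_eq_two_mul_lbWeight hr hle he)

end Chores
end
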